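/- arXiv:1607.04546 — 5 statements merged into one kernel-verified Lean document; each statement's English description precedes it below -/
import Mathlib

section
/- If {P_1, …, P_n} is an (n,l,m)-fusion frame over 𝔽 with 0 < l < m and n > d_𝔽(m) + 1, then max_{j≠k} tr(P_j P_k) ≥ l²/m, and if equality is achieved then n ≤ 2·d_𝔽(m). Moreover, if n = 2·d_𝔽(m) and equality is achieved, then for each index j there is exactly one index k ≠ j with tr(P_j P_k) = l(2l−m)/m, and tr(P_j P_k) = l²/m for every other index k ≠ j. -/
open Matrix

noncomputable section

variable {𝕜 : Type*} [RCLike 𝕜]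

/-- An `(n,l,m)`-fusion frame: a family of rank-`l` orthogonal projections on `𝕜^m`
satisfying the frame inequality. -/
def IsFusionFrame {ι : Type*} [Fintype ι] {m : ℕ} (l : ℕ)
    (P : ι → Matrix (Fin m) (Fin m) 𝕜) : Prop :=
  (∀ j, (P j).IsHermitian) ∧ (∀ j, P j * P j = P j) ∧ (∀ j, (P j).rank = l) ∧
  ∃ A B : ℝ, 0 < A ∧ A ≤ B ∧ ∀ x : Fin m → 𝕜,
    A * ∑ i, ‖x i‖ ^ 2 ≤ ∑ j, ∑ i, ‖(P j).mulVec x i‖ ^ 2 ∧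
    ∑ j, ∑ i, ‖(P j).mulVec x i‖ ^ 2 ≤ B * ∑ i, ‖x i‖ ^ 2

open scoped Classical in
/-- `d_𝔽(m)`: `(m+2)(m-1)/2` in the real case, `m² - 1` in the complex case. -/
noncomputable def dF (𝕜 : Type*) [RCLike 𝕜] (m : ℕ) : ℕ :=
  if (RCLike.I : 𝕜) = 0 then (m + 2) * (m - 1) / 2 else m ^ 2 - 1

section ObtuseFamilies

variable {ι V : Type*} [AddCommGroup V] [Module ℝ V]

/-- The component of `x` orthogonal to `u` with respect to the bilinear form `B`. -/
def perpPart (B : V →ₗ[ℝ] V →ₗ[ℝ] ℝ) (u x : V) : V :=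
  x - (B u x / B u u) • u

variable {B : V →ₗ[ℝ] V →ₗ[ℝ] ℝ}

lemma apply_perpPart {u : V} (hu : B u u ≠ 0) (x : V) : B u (perpPart B u x) = 0 := by
  simp [perpPart, hu]

lemma apply_perpPart_perpPart (hB : ∀ x y, B x y = B y x) {u : V} (hu : B u u ≠ 0) (x y : V) :
    B (perpPart B u x) (perpPart B u y) = B x y - B u x * B u y / B u u := by
  simp only [perpPart, map_sub, map_smul, LinearMap.sub_apply, LinearMap.smul_apply, smul_eq_mul,
    hB x u]
  field_simp
  ring

lemma perpPart_mem {u x : V} (hu : B u u ≠ 0) {W : Submodule ℝ V} (huW : u ∈ W) (hx : x ∈ W) :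
    perpPart B u x ∈ W ⊓ LinearMap.ker (B u) :=
  ⟨W.sub_mem hx (W.smul_mem _ huW), apply_perpPart hu x⟩

lemma finrank_inf_ker_lt [FiniteDimensional ℝ V] {u : V} (hu : B u u ≠ 0) {W : Submodule ℝ V}
    (huW : u ∈ W) : Module.finrank ℝ ↥(W ⊓ LinearMap.ker (B u)) < Module.finrank ℝ W := by
  refine Submodule.finrank_lt_finrank_of_lt (lt_of_le_of_ne inf_le_left fun h => hu ?_)
  exact (h.ge huW).2

/-- A family with pairwise negative products in a space of dimension at most `d` has at most
`d + 1` members. -/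
lemma card_le_succ_of_pairwise_neg [DecidableEq ι] [FiniteDimensional ℝ V]
    (hB : ∀ x y, B x y = B y x) (hpos : ∀ x, x ≠ 0 → 0 < B x x) (d : ℕ) :
    ∀ (W : Submodule ℝ V) (s : Finset ι) (v : ι → V), Module.finrank ℝ W ≤ d →
      (∀ i ∈ s, v i ∈ W) → (∀ i ∈ s, ∀ j ∈ s, i ≠ j → B (v i) (v j) < 0) → s.card ≤ d + 1 := by
  induction d with
  | zero =>
    intro W s v hW hv hneg
    refine Finset.card_le_one.2 fun i hi j hj => by_contra fun hij => ?_
    have hvi := hv i hi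
    rw [Submodule.finrank_eq_zero.1 (Nat.le_zero.1 hW), Submodule.mem_bot] at hvi
    simpa [hvi] using hneg i hi j hj hij
  | succ d ih =>
    intro W s v hW hv hneg
    by_cases hs : s.card ≤ 1
    · omega
    obtain ⟨i, hi, j, hj, hij⟩ := Finset.one_lt_card.1 (not_le.1 hs)
    have hvi : v i ≠ 0 := fun h => by simpa [h] using hneg i hi j hj hij
    have hu := hpos _ hvi
    have hlt := finrank_inf_ker_lt hu.ne' (hv i hi)
    have := ih _ (s.erase i) (fun k => perpPart B (v i) (v k)) (by omega)
      (fun k hk => perpPart_mem hu.ne' (hv i hi) (hv k (Finset.mem_of_mem_erase hk)))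
      (fun k hk k' hk' hne => by
        rw [apply_perpPart_perpPart hB hu.ne']
        have h1 := hneg k (Finset.mem_of_mem_erase hk) k' (Finset.mem_of_mem_erase hk') hne
        have h2 := hneg i hi k (Finset.mem_of_mem_erase hk) (Finset.ne_of_mem_erase hk).symm
        have h3 := hneg i hi k' (Finset.mem_of_mem_erase hk') (Finset.ne_of_mem_erase hk').symm
        have := div_pos (mul_pos_of_neg_of_neg h2 h3) hu
        linarith)
    rw [Finset.card_erase_of_mem hi] at this
    omega

lemma exists_neg_smul_of_perpPart_eq_zero (hpos : ∀ x, x ≠ 0 → 0 < B x x) {u x : V}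
    (hu : u ≠ 0) (hx : x ≠ 0) (hux : B u x ≤ 0) (h : perpPart B u x = 0) :
    ∃ c : ℝ, 0 < c ∧ x = -(c • u) := by
  have hxu : x = (B u x / B u u) • u := sub_eq_zero.1 h
  refine ⟨-(B u x / B u u), ?_, by rw [neg_smul, neg_neg]; exact hxu⟩
  refine neg_pos.2 (lt_of_le_of_ne (div_nonpos_of_nonpos_of_nonneg hux (hpos u hu).le) fun h0 => ?_)
  rw [h0, zero_smul] at hxu
  exact hx hxu

/-- A family of nonzero vectors with pairwise nonpositive products in a space of dimension at
most `d` has at most `2 * d` members. -/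
lemma card_le_two_mul_of_pairwise_nonpos [DecidableEq ι] [FiniteDimensional ℝ V]
    (hB : ∀ x y, B x y = B y x) (hpos : ∀ x, x ≠ 0 → 0 < B x x) (d : ℕ) :
    ∀ (W : Submodule ℝ V) (s : Finset ι) (v : ι → V), Module.finrank ℝ W ≤ d →
      (∀ i ∈ s, v i ∈ W) → (∀ i ∈ s, v i ≠ 0) →
      (∀ i ∈ s, ∀ j ∈ s, i ≠ j → B (v i) (v j) ≤ 0) → s.card ≤ 2 * d := by
  classical
  induction d with
  | zero =>
    intro W s v hW hv hne _
    rcases s.eq_empty_or_nonempty with rfl | ⟨i, hi⟩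
    · simp
    · have hvi := hv i hi
      rw [Submodule.finrank_eq_zero.1 (Nat.le_zero.1 hW), Submodule.mem_bot] at hvi
      exact absurd hvi (hne i hi)
  | succ d ih =>
    intro W s v hW hv hne hle
    rcases s.eq_empty_or_nonempty with rfl | ⟨i, hi⟩
    · simp
    have hu := hpos _ (hne i hi)
    have hlt := finrank_inf_ker_lt hu.ne' (hv i hi)
    set t := (s.erase i).filter (fun k => perpPart B (v i) (v k) = 0) with ht
    set r := (s.erase i).filter (fun k => ¬ perpPart B (v i) (v k) = 0) with hr
    have hsum : t.card + r.card = s.card - 1 := by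
      rw [← Finset.card_erase_of_mem hi]
      exact Finset.card_filter_add_card_filter_not _
    have hrle : r.card ≤ 2 * d := by
      refine ih (W ⊓ LinearMap.ker (B (v i))) r (fun k => perpPart B (v i) (v k)) (by omega) (fun k hk => ?_)
        (fun k hk => (Finset.mem_filter.1 hk).2) (fun k hk k' hk' hkk => ?_)
      · exact perpPart_mem hu.ne' (hv i hi)
          (hv k (Finset.mem_of_mem_erase (Finset.mem_filter.1 hk).1))
      · have hk := Finset.mem_erase.1 (Finset.mem_filter.1 hk).1
        have hk' := Finset.mem_erase.1 (Finset.mem_filter.1 hk').1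
        rw [apply_perpPart_perpPart hB hu.ne']
        have h1 := hle k hk.2 k' hk'.2 hkk
        have := div_nonneg (mul_nonneg_of_nonpos_of_nonpos (hle i hi k hk.2 hk.1.symm)
          (hle i hi k' hk'.2 hk'.1.symm)) hu.le
        linarith
    have htle : t.card ≤ 1 := by
      refine Finset.card_le_one.2 fun k hk k' hk' => by_contra fun hkk => ?_
      obtain ⟨hk, h0⟩ := Finset.mem_filter.1 hk
      obtain ⟨hk', h0'⟩ := Finset.mem_filter.1 hk'
      have hk := Finset.mem_erase.1 hk
      have hk' := Finset.mem_erase.1 hk'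
      obtain ⟨c, hc, h⟩ := exists_neg_smul_of_perpPart_eq_zero hpos (hne i hi) (hne k hk.2)
        (hle i hi k hk.2 hk.1.symm) h0
      obtain ⟨c', hc', h'⟩ := exists_neg_smul_of_perpPart_eq_zero hpos (hne i hi) (hne k' hk'.2)
        (hle i hi k' hk'.2 hk'.1.symm) h0'
      have h1 := hle k hk.2 k' hk'.2 hkk
      rw [h, h'] at h1
      have : 0 < c * (c' * B (v i) (v i)) := by positivity
      simp at h1
      linarith
    omega

/-- In an extremal family of nonzero vectors with pairwise nonpositive products, every vector has
a negative multiple in the family. -/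
lemma exists_neg_smul_of_card_eq_two_mul [DecidableEq ι] [FiniteDimensional ℝ V]
    (hB : ∀ x y, B x y = B y x) (hpos : ∀ x, x ≠ 0 → 0 < B x x) {d : ℕ}
    {W : Submodule ℝ V} {s : Finset ι} {v : ι → V} (hW : Module.finrank ℝ W ≤ d)
    (hv : ∀ i ∈ s, v i ∈ W) (hne : ∀ i ∈ s, v i ≠ 0)
    (hle : ∀ i ∈ s, ∀ j ∈ s, i ≠ j → B (v i) (v j) ≤ 0) (hcard : s.card = 2 * d)
    {i : ι} (hi : i ∈ s) : ∃ k ∈ s, k ≠ i ∧ ∃ c : ℝ, 0 < c ∧ v k = -(c • v i) := by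
  by_contra! hcon
  have hu := hpos _ (hne i hi)
  have hlt := finrank_inf_ker_lt hu.ne' (hv i hi)
  have := card_le_two_mul_of_pairwise_nonpos hB hpos (d - 1) _ (s.erase i)
    (fun k => perpPart B (v i) (v k)) (by omega)
    (fun k hk => perpPart_mem hu.ne' (hv i hi) (hv k (Finset.mem_of_mem_erase hk)))
    (fun k hk h0 => by
      have hk := Finset.mem_erase.1 hk
      obtain ⟨c, hc, h⟩ := exists_neg_smul_of_perpPart_eq_zero hpos (hne i hi) (hne k hk.2)
        (hle i hi k hk.2 hk.1.symm) h0
      exact hcon k hk.2 hk.1 c hc h)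
    (fun k hk k' hk' hkk => by
      have hk := Finset.mem_erase.1 hk
      have hk' := Finset.mem_erase.1 hk'
      rw [apply_perpPart_perpPart hB hu.ne']
      have h1 := hle k hk.2 k' hk'.2 hkk
      have := div_nonneg (mul_nonneg_of_nonpos_of_nonpos (hle i hi k hk.2 hk.1.symm)
        (hle i hi k' hk'.2 hk'.1.symm)) hu.le
      linarith)
  rw [Finset.card_erase_of_mem hi] at this
  omega

end ObtuseFamilies

section TracelessHermitian

/-- The real Hilbert–Schmidt form `re tr(Aᴴ C)`. -/
def hilbertSchmidt (𝕜 : Type*) [RCLike 𝕜] (m : ℕ) :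
    Matrix (Fin m) (Fin m) 𝕜 →ₗ[ℝ] Matrix (Fin m) (Fin m) 𝕜 →ₗ[ℝ] ℝ :=
  LinearMap.mk₂ ℝ (fun A C => RCLike.re (Aᴴ * C).trace)
    (fun A A' C => by simp [add_mul])
    (fun c A C => by simp [RCLike.smul_re])
    (fun A C C' => by simp [mul_add])
    (fun c A C => by simp [RCLike.smul_re])

lemma hilbertSchmidt_apply {m : ℕ} (A C : Matrix (Fin m) (Fin m) 𝕜) :
    hilbertSchmidt 𝕜 m A C = RCLike.re (Aᴴ * C).trace := rfl

lemma hilbertSchmidt_comm {m : ℕ} (A C : Matrix (Fin m) (Fin m) 𝕜) :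
    hilbertSchmidt 𝕜 m A C = hilbertSchmidt 𝕜 m C A := by
  rw [hilbertSchmidt_apply, hilbertSchmidt_apply, ← RCLike.conj_re, ← RCLike.star_def,
    ← trace_conjTranspose, conjTranspose_mul, conjTranspose_conjTranspose]

lemma hilbertSchmidt_self_pos {m : ℕ} (A : Matrix (Fin m) (Fin m) 𝕜) (hA : A ≠ 0) :
    0 < hilbertSchmidt 𝕜 m A A := by
  have h : hilbertSchmidt 𝕜 m A A = ∑ i, ∑ j, ‖A j i‖ ^ 2 := by
    simp only [hilbertSchmidt_apply, trace, diag_apply, mul_apply, conjTranspose_apply, map_sum]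
    refine Finset.sum_congr rfl fun i _ => Finset.sum_congr rfl fun j _ => ?_
    rw [RCLike.star_def, RCLike.conj_mul, ← RCLike.ofReal_pow, RCLike.ofReal_re]
  rw [h]
  obtain ⟨j, i, hji⟩ : ∃ j i, A j i ≠ 0 := by
    by_contra! h0
    exact hA (Matrix.ext h0)
  refine Finset.sum_pos' (fun i _ => by positivity) ⟨i, Finset.mem_univ _, ?_⟩
  exact Finset.sum_pos' (fun j _ => by positivity) ⟨j, Finset.mem_univ _, by positivity⟩

/-- The real vector space of traceless Hermitian matrices. -/
def tracelessHermitian (𝕜 : Type*) [RCLike 𝕜] (m : ℕ) :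
    Submodule ℝ (Matrix (Fin m) (Fin m) 𝕜) where
  carrier := {A | A.IsHermitian ∧ A.trace = 0}
  zero_mem' := ⟨isHermitian_zero, trace_zero ..⟩
  add_mem' hA hC := ⟨hA.1.add hC.1, by rw [trace_add, hA.2, hC.2, add_zero]⟩
  smul_mem' c A hA := ⟨by
    rw [IsHermitian, conjTranspose_smul, hA.1.eq, star_trivial], by rw [trace_smul, hA.2, smul_zero]⟩

/-- The strictly lower triangular entries of a matrix, together with the real parts of its
diagonal entries other than the last one. -/
def lowerEntries (𝕜 : Type*) [RCLike 𝕜] (k : ℕ) : Matrix (Fin (k + 1)) (Fin (k + 1)) 𝕜 →ₗ[ℝ]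
    ((Σ i : Fin (k + 1), Fin i) → 𝕜) × (Fin k → ℝ) where
  toFun A := (fun p => A p.1 (p.2.castLT (p.2.2.trans p.1.2)),
    fun i => RCLike.re (A i.castSucc i.castSucc))
  map_add' A C := by ext <;> simp
  map_smul' c A := by ext <;> simp [RCLike.smul_re]

lemma eq_zero_of_lowerEntries_eq_zero {k : ℕ} {A : Matrix (Fin (k + 1)) (Fin (k + 1)) 𝕜}
    (hA : A ∈ tracelessHermitian 𝕜 (k + 1)) (h : lowerEntries 𝕜 k A = 0) : A = 0 := by
  have hlow : ∀ i j : Fin (k + 1), j < i → A i j = 0 := fun i j hji =>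
    congrFun (congrArg Prod.fst h) ⟨i, ⟨j, hji⟩⟩
  have hdiag : ∀ i : Fin k, A i.castSucc i.castSucc = 0 := fun i => by
    rw [← hA.1.coe_re_apply_self]
    exact congrArg _ (congrFun (congrArg Prod.snd h) i) |>.trans RCLike.ofReal_zero
  have hlast : A (Fin.last k) (Fin.last k) = 0 := by
    have := hA.2
    simp only [trace, Fin.sum_univ_castSucc, diag_apply, hdiag] at this
    simpa using this
  ext i j
  rcases lt_trichotomy i j with hij | rfl | hij
  · rw [← hA.1.apply, hlow j i hij, star_zero, Matrix.zero_apply]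
  · induction i using Fin.lastCases with
    | last => exact hlast
    | cast i => exact hdiag i
  · exact hlow i j hij

lemma finrank_tracelessHermitian_le_add (k : ℕ) :
    Module.finrank ℝ (tracelessHermitian 𝕜 (k + 1)) ≤
      (∑ i ∈ Finset.range (k + 1), i) * Module.finrank ℝ 𝕜 + k := by
  have hinj : Function.Injective
      ((lowerEntries 𝕜 k).comp (tracelessHermitian 𝕜 (k + 1)).subtype) := by
    rw [injective_iff_map_eq_zero]
    exact fun A hA => Subtype.ext (eq_zero_of_lowerEntries_eq_zero A.2 hA)
  refine (LinearMap.finrank_le_finrank_of_injective hinj).trans (le_of_eq ?_)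
  simp [Module.finrank_prod, Module.finrank_pi_fintype, Finset.sum_range]

lemma finrank_tracelessHermitian_le {m : ℕ} (hm : 0 < m) :
    Module.finrank ℝ (tracelessHermitian 𝕜 m) ≤ dF 𝕜 m := by
  obtain ⟨k, rfl⟩ : ∃ k, m = k + 1 := ⟨m - 1, by omega⟩
  refine (finrank_tracelessHermitian_le_add k).trans ?_
  have hsum : (∑ i ∈ Finset.range (k + 1), i) * 2 = (k + 1) * k := Finset.sum_range_id_mul_two _
  unfold dF
  split_ifs with hI
  · rw [(RCLike.realLinearIsometryEquiv hI).toLinearEquiv.finrank_eq, Module.finrank_self,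
      Nat.le_div_iff_mul_le two_pos, Nat.add_sub_cancel]
    nlinarith
  · have := Nat.mul_le_mul_left (∑ i ∈ Finset.range (k + 1), i) (RCLike.finrank_le_two (K := 𝕜))
    refine Nat.le_sub_of_add_le ?_
    nlinarith

end TracelessHermitian

section Projections

lemma trace_eq_rank_of_mul_self {m : ℕ} {A : Matrix (Fin m) (Fin m) 𝕜} (hA : A * A = A) :
    A.trace = (A.rank : 𝕜) := by
  have h : IsIdempotentElem (toLin' A) := by
    rw [IsIdempotentElem, Module.End.mul_eq_comp, ← toLin'_mul, hA]
  rw [← trace_toLin'_eq, (LinearMap.IsIdempotentElem.isProj_range _ h).trace]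
  rfl

/-- The traceless part `A - (l/m) I` of a matrix of trace `l`. -/
def tracelessPart {m : ℕ} (l : ℕ) (A : Matrix (Fin m) (Fin m) 𝕜) : Matrix (Fin m) (Fin m) 𝕜 :=
  A - ((l : ℝ) / m) • (1 : Matrix (Fin m) (Fin m) 𝕜)

lemma tracelessPart_mem {l m : ℕ} (hm : 0 < m) {A : Matrix (Fin m) (Fin m) 𝕜}
    (hA : A.IsHermitian) (htr : A.trace = (l : 𝕜)) :
    tracelessPart l A ∈ tracelessHermitian 𝕜 m := by
  have hm' : (m : 𝕜) ≠ 0 := by exact_mod_cast hm.ne'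
  refine ⟨?_, ?_⟩
  · simp [IsHermitian, tracelessPart, hA.eq]
  · simp [tracelessPart, htr, RCLike.real_smul_eq_coe_mul, hm']

lemma hilbertSchmidt_tracelessPart {l m : ℕ} (hm : 0 < m) {A C : Matrix (Fin m) (Fin m) 𝕜}
    (hA : A.IsHermitian) (htA : A.trace = (l : 𝕜)) (htC : C.trace = (l : 𝕜)) :
    hilbertSchmidt 𝕜 m (tracelessPart l A) (tracelessPart l C) =
      RCLike.re (A * C).trace - (l : ℝ) ^ 2 / m := by
  have hm' : (m : ℝ) ≠ 0 := by exact_mod_cast hm.ne'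
  rw [hilbertSchmidt_apply]
  simp only [tracelessPart, conjTranspose_sub, hA.eq, conjTranspose_smul,
    conjTranspose_one, star_trivial, sub_mul, mul_sub, trace_sub, smul_mul_assoc, mul_smul_comm,
    one_mul, mul_one, trace_smul, trace_one, htA, htC, map_sub, RCLike.smul_re, RCLike.natCast_re,
    Fintype.card_fin]
  field_simp
  ring

end Projections

theorem stmt2 {n l m : ℕ} (hl : 0 < l) (hlm : l < m) (hn : dF 𝕜 m + 1 < n)
    (P : Fin n → Matrix (Fin m) (Fin m) 𝕜)
    (hFF : IsFusionFrame l P) :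
    -- the orthoplex bound: the maximal cross inner product is at least `l²/m`
    (∃ j k : Fin n, j ≠ k ∧ (l : ℝ) ^ 2 / m ≤ RCLike.re ((P j * P k).trace)) ∧
    -- if equality is achieved (the maximum equals `l²/m`), then `n ≤ 2 d_𝔽(m)`
    ((∀ j k : Fin n, j ≠ k → RCLike.re ((P j * P k).trace) ≤ (l : ℝ) ^ 2 / m) →
      n ≤ 2 * dF 𝕜 m) ∧
    -- if moreover `n = 2 d_𝔽(m)`, each row has exactly one partner with value
    -- `l(2l-m)/m`, and all other cross inner products equal `l²/m`
    (n = 2 * dF 𝕜 m →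
      (∀ j k : Fin n, j ≠ k → RCLike.re ((P j * P k).trace) ≤ (l : ℝ) ^ 2 / m) →
      ∀ j : Fin n,
        (∃! k : Fin n, k ≠ j ∧
          RCLike.re ((P j * P k).trace) = (l : ℝ) * (2 * (l : ℝ) - m) / m) ∧
        (∀ k : Fin n, k ≠ j →
          RCLike.re ((P j * P k).trace) ≠ (l : ℝ) * (2 * (l : ℝ) - m) / m →
          RCLike.re ((P j * P k).trace) = (l : ℝ) ^ 2 / m)) := by
  obtain ⟨hH, hI, hR, -⟩ := hFF
  have hm : 0 < m := by omega
  have hm' : (0 : ℝ) < m := by exact_mod_cast hm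
  have htr : ∀ j, (P j).trace = (l : 𝕜) := fun j => by
    rw [trace_eq_rank_of_mul_self (hI j), hR j]
  have hinner : ∀ j k, hilbertSchmidt 𝕜 m (tracelessPart l (P j)) (tracelessPart l (P k)) =
      RCLike.re ((P j * P k).trace) - (l : ℝ) ^ 2 / m := fun j k =>
    hilbertSchmidt_tracelessPart hm (hH j) (htr j) (htr k)
  have hself : ∀ j, hilbertSchmidt 𝕜 m (tracelessPart l (P j)) (tracelessPart l (P j)) =
      (l : ℝ) - (l : ℝ) ^ 2 / m := fun j => by
    rw [hinner, hI, htr, RCLike.natCast_re]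
  have hpos : 0 < (l : ℝ) - (l : ℝ) ^ 2 / m := by
    have h1 : (l : ℝ) < m := by exact_mod_cast hlm
    have h2 : (0 : ℝ) < l := by exact_mod_cast hl
    rw [sub_pos, div_lt_iff₀ hm']
    nlinarith
  have hmem : ∀ j ∈ Finset.univ, tracelessPart l (P j) ∈ tracelessHermitian 𝕜 m := fun j _ =>
    tracelessPart_mem hm (hH j) (htr j)
  have hne : ∀ j ∈ Finset.univ, tracelessPart l (P j) ≠ 0 := fun j _ h0 => by
    have := hself j
    rw [h0, map_zero] at this
    exact hpos.ne this
  have hdim := finrank_tracelessHermitian_le (𝕜 := 𝕜) hm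
  refine ⟨?_, fun hle => ?_, fun hn2 hle j => ?_⟩
  · by_contra! hcon
    have := card_le_succ_of_pairwise_neg hilbertSchmidt_comm hilbertSchmidt_self_pos _ _
      Finset.univ (fun j => tracelessPart l (P j)) hdim hmem (fun j _ k _ hjk => by
        rw [hinner]
        linarith [hcon j k hjk])
    rw [Finset.card_fin] at this
    omega
  · have := card_le_two_mul_of_pairwise_nonpos hilbertSchmidt_comm hilbertSchmidt_self_pos _ _
      Finset.univ (fun j => tracelessPart l (P j)) hdim hmem hne (fun j _ k _ hjk => by
        rw [hinner]
        linarith [hle j k hjk])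
    rwa [Finset.card_fin] at this
  · obtain ⟨k, -, hkj, c, hc, hk⟩ := exists_neg_smul_of_card_eq_two_mul hilbertSchmidt_comm
      hilbertSchmidt_self_pos hdim hmem hne (fun j _ k _ hjk => by
        rw [hinner]
        linarith [hle j k hjk]) (by rw [Finset.card_fin, hn2]) (Finset.mem_univ j)
    have hscale : ∀ i, RCLike.re ((P k * P i).trace) - (l : ℝ) ^ 2 / m =
        -(c * (RCLike.re ((P j * P i).trace) - (l : ℝ) ^ 2 / m)) := fun i => by
      rw [← hinner, ← hinner, hk]
      simp
    have hc1 : c = 1 := by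
      have h1 := hself k
      rw [hk] at h1
      simp only [map_neg, map_smul, LinearMap.neg_apply, LinearMap.smul_apply, smul_eq_mul,
        hself j] at h1
      have h2 : (c - 1) * ((c + 1) * ((l : ℝ) - (l : ℝ) ^ 2 / m)) = 0 := by linarith
      have h3 : (c + 1) * ((l : ℝ) - (l : ℝ) ^ 2 / m) ≠ 0 := by positivity
      linarith [(mul_eq_zero.1 h2).resolve_right h3]
    have hval : (l : ℝ) * (2 * (l : ℝ) - m) / m =
        (l : ℝ) ^ 2 / m - ((l : ℝ) - (l : ℝ) ^ 2 / m) := by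
      field_simp
      ring
    have hpartner : RCLike.re ((P j * P k).trace) = (l : ℝ) * (2 * (l : ℝ) - m) / m := by
      have h1 := hscale j
      rw [hc1, trace_mul_comm (P k), ← hinner j j, hself] at h1
      linarith
    have hother : ∀ i, i ≠ j → i ≠ k → RCLike.re ((P j * P i).trace) = (l : ℝ) ^ 2 / m := by
      intro i hij hik
      have h1 := hscale i
      rw [hc1] at h1
      linarith [hle j i hij.symm, hle k i hik.symm]
    refine ⟨⟨k, ⟨hkj, hpartner⟩, fun i hi => by_contra fun hik => ?_⟩, fun i hij hi => ?_⟩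
    · linarith [hother i hi.1 hik, hi.2]
    · exact hother i hij fun hik => hi (hik ▸ hpartner)

end
end

section
/- Let t ≥ 1 and let {P_1, …, P_n} be an (n,l,m)-fusion frame over 𝔽. Then (1/n²) · ∑_{i=1}^n ∑_{j=1}^n (tr(P_i P_j))^t ≥ tr(K_{t,l,m}²), and equality holds if and only if the fusion frame is a Grassmannian t-design. -/
open Matrix MeasureTheory

noncomputable section

variable {𝕜 : Type*} [RCLike 𝕜]

attribute [local instance] Matrix.frobeniusNormedAddCommGroup Matrix.frobeniusNormedSpace

instance matrixMeasurableSpace {m : ℕ} : MeasurableSpace (Matrix (Fin m) (Fin m) 𝕜) :=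
  inferInstanceAs (MeasurableSpace (Fin m → Fin m → 𝕜))

/-- the `t`-fold Kronecker power of a matrix -/
def kronPow {m : ℕ} (t : ℕ) (X : Matrix (Fin m) (Fin m) 𝕜) :
    Matrix (Fin t → Fin m) (Fin t → Fin m) 𝕜 :=
  Matrix.of fun i j => ∏ s, X (i s) (j s)

/-- A Grassmannian `t`-design: the sum of the `t`-th Kronecker powers of the projections
is invariant under simultaneous conjugation by any unitary (orthogonal, if `𝕜 = ℝ`). -/
def IsGrassmannianDesign {ι : Type*} [Fintype ι] {m : ℕ} (t : ℕ)
    (P : ι → Matrix (Fin m) (Fin m) 𝕜) : Prop :=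
  ∀ U : Matrix.unitaryGroup (Fin m) 𝕜,
    ∑ j, kronPow t (P j) =
      ∑ j, kronPow t ((U : Matrix (Fin m) (Fin m) 𝕜) * P j *
        star (U : Matrix (Fin m) (Fin m) 𝕜))

lemma kronPow_mul {m : ℕ} (t : ℕ) (A B : Matrix (Fin m) (Fin m) 𝕜) :
    kronPow t (A * B) = kronPow t A * kronPow t B := by
  ext i j
  simp only [kronPow, Matrix.of_apply, Matrix.mul_apply, Finset.prod_univ_sum,
    Fintype.piFinset_univ, Finset.prod_mul_distrib]

lemma kronPow_one {m : ℕ} (t : ℕ) : kronPow t (1 : Matrix (Fin m) (Fin m) 𝕜) = 1 := by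
  ext i j
  simp only [kronPow, Matrix.of_apply, Matrix.one_apply, Finset.prod_ite_zero, Finset.prod_const_one,
    Finset.mem_univ, true_implies, funext_iff]

lemma kronPow_conjTranspose {m : ℕ} (t : ℕ) (A : Matrix (Fin m) (Fin m) 𝕜) :
    kronPow t Aᴴ = (kronPow t A)ᴴ := by
  ext i j
  simp [kronPow, Matrix.conjTranspose_apply]

lemma trace_kronPow {m : ℕ} (t : ℕ) (A : Matrix (Fin m) (Fin m) 𝕜) :
    (kronPow t A).trace = A.trace ^ t := by
  simp only [Matrix.trace, Matrix.diag, kronPow, Matrix.of_apply]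
  rw [← Fin.prod_const, Finset.prod_univ_sum, Fintype.piFinset_univ]

lemma trace_kronPow_conj_mul_kronPow_conj {m t : ℕ} (V : Matrix.unitaryGroup (Fin m) 𝕜)
    (X Y : Matrix (Fin t → Fin m) (Fin t → Fin m) 𝕜) :
    (kronPow t (V : Matrix (Fin m) (Fin m) 𝕜) * X *
        (kronPow t (V : Matrix (Fin m) (Fin m) 𝕜))ᴴ *
      (kronPow t (V : Matrix (Fin m) (Fin m) 𝕜) * Y *
        (kronPow t (V : Matrix (Fin m) (Fin m) 𝕜))ᴴ)).trace = (X * Y).trace := by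
  set W := kronPow t (V : Matrix (Fin m) (Fin m) 𝕜)
  have hW : Wᴴ * W = 1 := by
    rw [← kronPow_conjTranspose, ← kronPow_mul, ← Matrix.star_eq_conjTranspose,
      Unitary.coe_star_mul_self, kronPow_one]
  calc _ = (W * (X * (Wᴴ * W) * Y * Wᴴ)).trace := by simp only [Matrix.mul_assoc]
    _ = (X * Y).trace := by
      rw [Matrix.trace_mul_comm, hW, Matrix.mul_one, Matrix.mul_assoc, hW, Matrix.mul_one]

lemma kronPow_conj {m : ℕ} (t : ℕ) (V : Matrix.unitaryGroup (Fin m) 𝕜)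
    (A : Matrix (Fin m) (Fin m) 𝕜) :
    kronPow t ((V : Matrix (Fin m) (Fin m) 𝕜) * A * star (V : Matrix (Fin m) (Fin m) 𝕜)) =
      kronPow t (V : Matrix (Fin m) (Fin m) 𝕜) * kronPow t A *
        (kronPow t (V : Matrix (Fin m) (Fin m) 𝕜))ᴴ := by
  rw [kronPow_mul, kronPow_mul, Matrix.star_eq_conjTranspose, kronPow_conjTranspose]

open Polynomial in
lemma charpoly_of_isHermitian_of_idempotent {m : ℕ} {P : Matrix (Fin m) (Fin m) 𝕜}
    (hP : P.IsHermitian) (hP2 : P * P = P) :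
    P.charpoly = (X - 1) ^ P.rank * X ^ (m - P.rank) := by
  have h01 : ∀ i, (hP.eigenvalues i = 0 ∨ hP.eigenvalues i = 1) := by
    intro i
    have hs := hP.eigenvalues_mem_spectrum_real i
    exact (IsIdempotentElem.spectrum_subset ℝ hP2) hs
  have hcard : (Finset.univ.filter fun i => hP.eigenvalues i ≠ 0).card = P.rank := by
    rw [hP.rank_eq_card_non_zero_eigs, Fintype.card_subtype]
  have hcard' : (Finset.univ.filter fun i => ¬ hP.eigenvalues i ≠ 0).card = m - P.rank := by
    have := Finset.card_filter_add_card_filter_not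
      (s := (Finset.univ : Finset (Fin m))) (fun i => hP.eigenvalues i ≠ 0)
    rw [hcard, Finset.card_univ, Fintype.card_fin] at this
    omega
  rw [hP.charpoly_eq, ← Finset.prod_filter_mul_prod_filter_not _ (fun i => hP.eigenvalues i ≠ 0),
    ← hcard', ← hcard]
  congr 1
  · refine Finset.prod_eq_pow_card fun i hi => ?_
    rw [(h01 i).resolve_left (Finset.mem_filter.1 hi).2]
    simp
  · refine Finset.prod_eq_pow_card fun i hi => ?_
    rw [not_not.1 (Finset.mem_filter.1 hi).2]
    simp

lemma exists_unitary_conj_of_rank_eq {m : ℕ} {P Q : Matrix (Fin m) (Fin m) 𝕜}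
    (hP : P.IsHermitian) (hP2 : P * P = P) (hQ : Q.IsHermitian) (hQ2 : Q * Q = Q)
    (hr : P.rank = Q.rank) :
    ∃ V : Matrix.unitaryGroup (Fin m) 𝕜,
      P = (V : Matrix (Fin m) (Fin m) 𝕜) * Q * star (V : Matrix (Fin m) (Fin m) 𝕜) := by
  have he : hP.eigenvalues = hQ.eigenvalues := by
    rw [IsHermitian.eigenvalues_eq_eigenvalues_iff,
      charpoly_of_isHermitian_of_idempotent hP hP2,
      charpoly_of_isHermitian_of_idempotent hQ hQ2, hr]
  refine ⟨hP.eigenvectorUnitary * star hQ.eigenvectorUnitary, ?_⟩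
  have hd := hQ.conjStarAlgAut_star_eigenvectorUnitary
  rw [Unitary.conjStarAlgAut_star_apply] at hd
  conv_lhs => rw [hP.spectral_theorem, he, ← hd, Unitary.conjStarAlgAut_apply]
  simp [Matrix.mul_assoc]

/-- The trace of a product of two Hermitian matrices is real. -/
lemma re_trace_mul_pow {m : ℕ} (t : ℕ) {A B : Matrix (Fin m) (Fin m) 𝕜}
    (hA : A.IsHermitian) (hB : B.IsHermitian) :
    RCLike.re ((A * B).trace ^ t) = RCLike.re ((A * B).trace) ^ t := by
  have h : (starRingEnd 𝕜) (A * B).trace = (A * B).trace := by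
    rw [starRingEnd_apply, ← Matrix.trace_conjTranspose, Matrix.conjTranspose_mul, hA.eq, hB.eq,
      Matrix.trace_mul_comm]
  rw [RCLike.conj_eq_iff_re] at h
  conv_lhs => rw [← h, ← RCLike.ofReal_pow, RCLike.ofReal_re]

/-- Linear functionals on a finite-dimensional space commute with the integral of a function whose
coordinates with respect to some finite spanning family are integrable. -/
lemma map_integral_of_eq_sum_smul {α ι E : Type*} [MeasurableSpace α] {μ : Measure α} [Fintype ι]
    [NormedAddCommGroup E] [NormedSpace 𝕜 E] [NormedSpace ℝ E] [FiniteDimensional 𝕜 E]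
    {f : α → E} {c : ι → α → 𝕜} (e : ι → E) (hc : ∀ i, Integrable (c i) μ)
    (hf : ∀ x, f x = ∑ i, c i x • e i) (L : E →ₗ[𝕜] 𝕜) :
    L (∫ x, f x ∂μ) = ∫ x, L (f x) ∂μ := by
  have := FiniteDimensional.complete 𝕜 E
  have hint : Integrable f μ := by
    rw [funext hf]
    exact integrable_finsetSum _ fun i _ => (hc i).smul_const _
  exact (L.toContinuousLinearMap.integral_comp_comm hint).symm

section CoherenceTensor

variable {m : ℕ} (t : ℕ) (Q : Matrix (Fin m) (Fin m) 𝕜)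
  (μ : Measure (Matrix.unitaryGroup (Fin m) 𝕜)) [IsProbabilityMeasure μ]

lemma measurable_kronPow_conj_apply (i j : Fin t → Fin m) :
    Measurable fun U : Matrix.unitaryGroup (Fin m) 𝕜 =>
      kronPow t ((U : Matrix (Fin m) (Fin m) 𝕜) * Q *
        star (U : Matrix (Fin m) (Fin m) 𝕜)) i j := by
  have hentry : ∀ a b, Measurable fun U : Matrix.unitaryGroup (Fin m) 𝕜 =>
      (U : Matrix (Fin m) (Fin m) 𝕜) a b := fun a b =>
    (measurable_pi_apply b).comp ((measurable_pi_apply a).comp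
      (measurable_subtype_coe (p := (· ∈ Matrix.unitaryGroup (Fin m) 𝕜))))
  simp only [kronPow, Matrix.of_apply, Matrix.mul_apply, Matrix.star_apply]
  refine Finset.measurable_prod _ fun s _ => Finset.measurable_sum _ fun b _ => ?_
  refine (Finset.measurable_sum _ fun a _ => (hentry _ _).mul_const _).mul ?_
  exact RCLike.continuous_conj.measurable.comp (hentry _ _)

lemma norm_kronPow_conj_apply_le (U : Matrix.unitaryGroup (Fin m) 𝕜) (i j : Fin t → Fin m) :
    ‖kronPow t ((U : Matrix (Fin m) (Fin m) 𝕜) * Q *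
        star (U : Matrix (Fin m) (Fin m) 𝕜)) i j‖ ≤ (∑ b, ∑ a, ‖Q a b‖) ^ t := by
  have hU := fun a b => entry_norm_bound_of_unitary U.2 a b
  simp only [kronPow, Matrix.of_apply, Matrix.mul_apply, Matrix.star_apply, norm_prod]
  refine (Finset.prod_le_prod (fun _ _ => norm_nonneg _) fun s _ => ?_).trans_eq
    (by rw [Finset.prod_const, Finset.card_univ, Fintype.card_fin])
  refine (norm_sum_le _ _).trans (Finset.sum_le_sum fun b _ => ?_)
  rw [norm_mul, norm_star]
  refine (mul_le_of_le_one_right (norm_nonneg _) (hU _ _)).trans ?_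
  refine (norm_sum_le _ _).trans (Finset.sum_le_sum fun a _ => ?_)
  rw [norm_mul]
  exact mul_le_of_le_one_left (norm_nonneg _) (hU _ _)

lemma integrable_kronPow_conj_apply (i j : Fin t → Fin m) :
    Integrable (fun U : Matrix.unitaryGroup (Fin m) 𝕜 =>
      kronPow t ((U : Matrix (Fin m) (Fin m) 𝕜) * Q *
        star (U : Matrix (Fin m) (Fin m) 𝕜)) i j) μ :=
  Integrable.of_bound (measurable_kronPow_conj_apply t Q i j).aestronglyMeasurable _
    (Filter.Eventually.of_forall fun U => norm_kronPow_conj_apply_le t Q U i j)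

lemma map_integral_kronPow_conj (L : Matrix (Fin t → Fin m) (Fin t → Fin m) 𝕜 →ₗ[𝕜] 𝕜) :
    L (∫ U : Matrix.unitaryGroup (Fin m) 𝕜, kronPow t ((U : Matrix (Fin m) (Fin m) 𝕜) * Q *
        star (U : Matrix (Fin m) (Fin m) 𝕜)) ∂μ) =
      ∫ U : Matrix.unitaryGroup (Fin m) 𝕜, L (kronPow t ((U : Matrix (Fin m) (Fin m) 𝕜) * Q *
        star (U : Matrix (Fin m) (Fin m) 𝕜))) ∂μ := by
  refine map_integral_of_eq_sum_smul (fun p : (Fin t → Fin m) × (Fin t → Fin m) =>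
    Matrix.single p.1 p.2 (1 : 𝕜))
    (fun p => integrable_kronPow_conj_apply t Q μ p.1 p.2) (fun U => ?_) L
  conv_lhs => rw [Matrix.matrix_eq_sum_single (kronPow t _)]
  simp [Matrix.smul_single, Fintype.sum_prod_type]

lemma trace_mul_integral_kronPow_conj (A : Matrix (Fin t → Fin m) (Fin t → Fin m) 𝕜) :
    (A * ∫ U : Matrix.unitaryGroup (Fin m) 𝕜, kronPow t ((U : Matrix (Fin m) (Fin m) 𝕜) * Q *
        star (U : Matrix (Fin m) (Fin m) 𝕜)) ∂μ).trace =
      ∫ U : Matrix.unitaryGroup (Fin m) 𝕜, (A * kronPow t ((U : Matrix (Fin m) (Fin m) 𝕜) * Q *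
        star (U : Matrix (Fin m) (Fin m) 𝕜))).trace ∂μ :=
  map_integral_kronPow_conj t Q μ
    (Matrix.traceLinearMap _ 𝕜 𝕜 ∘ₗ LinearMap.mulLeft 𝕜 A)

lemma isHermitian_integral_kronPow_conj (hQ : Q.IsHermitian) :
    (∫ U : Matrix.unitaryGroup (Fin m) 𝕜, kronPow t ((U : Matrix (Fin m) (Fin m) 𝕜) * Q *
        star (U : Matrix (Fin m) (Fin m) 𝕜)) ∂μ).IsHermitian := by
  have hentry := fun i j => map_integral_kronPow_conj t Q μ (Matrix.entryLinearMap 𝕜 𝕜 i j)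
  simp only [Matrix.entryLinearMap_apply] at hentry
  ext i j
  rw [Matrix.conjTranspose_apply, hentry, hentry, ← starRingEnd_apply, ← integral_conj]
  refine integral_congr_ae (Filter.Eventually.of_forall fun U => ?_)
  simp only
  rw [starRingEnd_apply, ← Matrix.conjTranspose_apply, kronPow_conj, Matrix.conjTranspose_mul,
    Matrix.conjTranspose_mul, ← kronPow_conjTranspose t Q, hQ.eq,
    Matrix.conjTranspose_conjTranspose, Matrix.mul_assoc]

lemma integral_kronPow_conj_invariant
    (hinv : ∀ V : Matrix.unitaryGroup (Fin m) 𝕜, Measure.map (fun U => V * U) μ = μ)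
    (V : Matrix.unitaryGroup (Fin m) 𝕜) :
    kronPow t (V : Matrix (Fin m) (Fin m) 𝕜) *
        (∫ U : Matrix.unitaryGroup (Fin m) 𝕜, kronPow t ((U : Matrix (Fin m) (Fin m) 𝕜) * Q *
          star (U : Matrix (Fin m) (Fin m) 𝕜)) ∂μ) *
        (kronPow t (V : Matrix (Fin m) (Fin m) 𝕜))ᴴ =
      ∫ U : Matrix.unitaryGroup (Fin m) 𝕜, kronPow t ((U : Matrix (Fin m) (Fin m) 𝕜) * Q *
          star (U : Matrix (Fin m) (Fin m) 𝕜)) ∂μ := by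
  have hmeas : AEMeasurable (fun U => V * U) μ := by
    by_contra h
    have h0 := hinv V
    rw [Measure.map_of_not_aemeasurable h] at h0
    exact IsProbabilityMeasure.ne_zero μ h0.symm
  ext i j
  have hentry := map_integral_kronPow_conj t Q μ (Matrix.entryLinearMap 𝕜 𝕜 i j)
  simp only [Matrix.entryLinearMap_apply] at hentry
  have hshift := integral_map hmeas
    (measurable_kronPow_conj_apply t Q i j).aestronglyMeasurable
  rw [hinv V] at hshift
  rw [hentry, hshift]
  refine (map_integral_kronPow_conj t Q μ (Matrix.entryLinearMap 𝕜 𝕜 i j ∘ₗ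
    LinearMap.mulRight 𝕜 (kronPow t (V : Matrix (Fin m) (Fin m) 𝕜))ᴴ ∘ₗ
    LinearMap.mulLeft 𝕜 (kronPow t (V : Matrix (Fin m) (Fin m) 𝕜)))).trans ?_
  refine integral_congr_ae (Filter.Eventually.of_forall fun U => ?_)
  simp only [LinearMap.comp_apply, LinearMap.mulLeft_apply, LinearMap.mulRight_apply,
    Matrix.entryLinearMap_apply]
  rw [← kronPow_conj]
  simp [Matrix.mul_assoc]

end CoherenceTensor

/-- If `X` is invariant under conjugation by the Kronecker powers of unitaries, then its trace
pairing with `kronPow t` of a conjugate of `Q` is that with `kronPow t Q`. -/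
lemma trace_mul_kronPow_conj_of_invariant {m t : ℕ}
    {X : Matrix (Fin t → Fin m) (Fin t → Fin m) 𝕜} (V : Matrix.unitaryGroup (Fin m) 𝕜)
    (hX : kronPow t (V : Matrix (Fin m) (Fin m) 𝕜) * X *
      (kronPow t (V : Matrix (Fin m) (Fin m) 𝕜))ᴴ = X) (Q : Matrix (Fin m) (Fin m) 𝕜) :
    (X * kronPow t ((V : Matrix (Fin m) (Fin m) 𝕜) * Q *
      star (V : Matrix (Fin m) (Fin m) 𝕜))).trace = (X * kronPow t Q).trace := by
  rw [kronPow_conj]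
  nth_rw 1 [← hX]
  exact trace_kronPow_conj_mul_kronPow_conj V X _

lemma IsFusionFrame.dim_eq_zero_of_isEmpty {ι : Type*} [Fintype ι] [IsEmpty ι] {l m : ℕ}
    {P : ι → Matrix (Fin m) (Fin m) 𝕜} (h : IsFusionFrame l P) : m = 0 := by
  obtain ⟨-, -, -, A, B, hA, -, hAB⟩ := h
  have h1 := (hAB fun _ => 1).1
  simp only [norm_one, one_pow, Finset.sum_const, Finset.card_univ, Fintype.card_fin, nsmul_eq_mul,
    mul_one, Finset.univ_eq_empty, Finset.sum_empty] at h1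
  by_contra hm
  have : (0 : ℝ) < m := by exact_mod_cast Nat.pos_of_ne_zero hm
  exact absurd h1 (not_le.2 (mul_pos hA this))

open scoped ComplexOrder in
lemma re_trace_conjTranspose_mul_self_nonneg {κ : Type*} [Fintype κ] (D : Matrix κ κ 𝕜) :
    0 ≤ RCLike.re (Dᴴ * D).trace :=
  (RCLike.nonneg_iff.1 (Matrix.posSemidef_conjTranspose_mul_self D).trace_nonneg).1

open scoped ComplexOrder in
lemma eq_zero_of_re_trace_conjTranspose_mul_self {κ : Type*} [Fintype κ] {D : Matrix κ κ 𝕜}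
    (h : RCLike.re (Dᴴ * D).trace = 0) : D = 0 := by
  have him := (RCLike.nonneg_iff.1 (Matrix.posSemidef_conjTranspose_mul_self D).trace_nonneg).2
  refine Matrix.trace_conjTranspose_mul_self_eq_zero_iff.1 (RCLike.ext ?_ ?_)
  · rw [h, map_zero]
  · rw [him, map_zero]

theorem stmt5 {n l m t : ℕ} (ht : 1 ≤ t)
    (P : Fin n → Matrix (Fin m) (Fin m) 𝕜)
    (hFF : IsFusionFrame l P)
    -- a fixed rank-`l` orthogonal projection used to define the `t`-coherence tensor
    (Q : Matrix (Fin m) (Fin m) 𝕜)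
    (hQ : Q.IsHermitian ∧ Q * Q = Q ∧ Q.rank = l)
    -- `μ` is the normalized Haar measure on the unitary (orthogonal) group
    (μ : Measure (Matrix.unitaryGroup (Fin m) 𝕜)) [IsProbabilityMeasure μ]
    (hinv : ∀ V : Matrix.unitaryGroup (Fin m) 𝕜,
      Measure.map (fun U => V * U) μ = μ)
    -- the `t`-coherence tensor
    (K : Matrix (Fin t → Fin m) (Fin t → Fin m) 𝕜)
    (hK : K = ∫ U : Matrix.unitaryGroup (Fin m) 𝕜,
      kronPow t ((U : Matrix (Fin m) (Fin m) 𝕜) * Q *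
        star (U : Matrix (Fin m) (Fin m) 𝕜)) ∂μ) :
    (RCLike.re ((K * K).trace) ≤
      1 / (n : ℝ) ^ 2 * ∑ i, ∑ j, (RCLike.re ((P i * P j).trace)) ^ t) ∧
    (1 / (n : ℝ) ^ 2 * ∑ i, ∑ j, (RCLike.re ((P i * P j).trace)) ^ t =
        RCLike.re ((K * K).trace) ↔
      IsGrassmannianDesign t P) := by
  obtain ⟨hQh, hQ2, hQr⟩ := hQ
  have hKh : K.IsHermitian := hK ▸ isHermitian_integral_kronPow_conj t Q μ hQh
  have hKinv : ∀ V : Matrix.unitaryGroup (Fin m) 𝕜,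
      kronPow t (V : Matrix (Fin m) (Fin m) 𝕜) * K *
        (kronPow t (V : Matrix (Fin m) (Fin m) 𝕜))ᴴ = K :=
    fun V => hK ▸ integral_kronPow_conj_invariant t Q μ hinv V
  have htrK : ∀ X : Matrix (Fin t → Fin m) (Fin t → Fin m) 𝕜,
      (∀ V : Matrix.unitaryGroup (Fin m) 𝕜, kronPow t (V : Matrix (Fin m) (Fin m) 𝕜) * X *
        (kronPow t (V : Matrix (Fin m) (Fin m) 𝕜))ᴴ = X) →
      (X * K).trace = (X * kronPow t Q).trace := by
    intro X hX
    rw [hK, trace_mul_integral_kronPow_conj]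
    simp only [trace_mul_kronPow_conj_of_invariant _ (hX _) Q, integral_const, probReal_univ,
      one_smul]
  have hconj : ∀ j, ∃ V : Matrix.unitaryGroup (Fin m) 𝕜,
      P j = (V : Matrix (Fin m) (Fin m) 𝕜) * Q * star (V : Matrix (Fin m) (Fin m) 𝕜) := fun j =>
    exists_unitary_conj_of_rank_eq (hFF.1 j) (hFF.2.1 j) hQh hQ2 ((hFF.2.2.1 j).trans hQr.symm)
  set S := ∑ j, kronPow t (P j) with hS
  have hSh : S.IsHermitian := by
    rw [Matrix.IsHermitian, hS, Matrix.conjTranspose_sum]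
    exact Finset.sum_congr rfl fun j _ => by rw [← kronPow_conjTranspose, (hFF.1 j).eq]
  have htrS : ∀ X : Matrix (Fin t → Fin m) (Fin t → Fin m) 𝕜,
      (∀ V : Matrix.unitaryGroup (Fin m) 𝕜, kronPow t (V : Matrix (Fin m) (Fin m) 𝕜) * X *
        (kronPow t (V : Matrix (Fin m) (Fin m) 𝕜))ᴴ = X) →
      (X * S).trace = n * (X * K).trace := by
    intro X hX
    rw [htrK X hX, hS, Matrix.mul_sum, Matrix.trace_sum,
      Finset.sum_congr rfl (g := fun _ => (X * kronPow t Q).trace)]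
    · simp
    · intro j _
      obtain ⟨V, hV⟩ := hconj j
      rw [hV, trace_mul_kronPow_conj_of_invariant V (hX V)]
  have hSS : RCLike.re (S * S).trace = ∑ i, ∑ j, (RCLike.re ((P i * P j).trace)) ^ t := by
    simp only [hS, Finset.sum_mul, Finset.mul_sum, Matrix.trace_sum, map_sum]
    refine Finset.sum_comm.trans
      (Finset.sum_congr rfl fun i _ => Finset.sum_congr rfl fun j _ => ?_)
    rw [← kronPow_mul, trace_kronPow, re_trace_mul_pow t (hFF.1 _) (hFF.1 _)]
  rw [← hSS]
  have hdesign : IsGrassmannianDesign t P ↔ ∀ V : Matrix.unitaryGroup (Fin m) 𝕜,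
      kronPow t (V : Matrix (Fin m) (Fin m) 𝕜) * S *
        (kronPow t (V : Matrix (Fin m) (Fin m) 𝕜))ᴴ = S := by
    refine forall_congr' fun V => ?_
    simp only [kronPow_conj, ← hS, ← Matrix.mul_sum, ← Matrix.sum_mul]
    exact eq_comm
  rw [hdesign]
  rcases Nat.eq_zero_or_pos n with rfl | hn
  · obtain rfl := hFF.dim_eq_zero_of_isEmpty
    have : Nonempty (Fin t) := ⟨⟨0, ht⟩⟩
    simp [eq_iff_true_of_subsingleton]
  have hn' : (0 : ℝ) < (n : ℝ) ^ 2 := by positivity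
  set D := S - (n : 𝕜) • K with hD
  have hDh : Dᴴ = D := by
    rw [hD, Matrix.conjTranspose_sub, Matrix.conjTranspose_smul, hSh.eq, hKh.eq]
    simp
  have hDD : (Dᴴ * D).trace = (S * S).trace - (n : 𝕜) ^ 2 * (K * K).trace := by
    rw [hDh, hD]
    simp only [Matrix.sub_mul, Matrix.mul_sub, Matrix.smul_mul, Matrix.mul_smul, Matrix.trace_sub,
      Matrix.trace_smul, smul_eq_mul, Matrix.trace_mul_comm S K, htrS K hKinv]
    ring
  have hre : RCLike.re (Dᴴ * D).trace =
      RCLike.re (S * S).trace - (n : ℝ) ^ 2 * RCLike.re (K * K).trace := by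
    rw [hDD, map_sub, ← RCLike.ofReal_natCast, ← RCLike.ofReal_pow, RCLike.re_ofReal_mul]
  refine ⟨?_, fun h V => ?_, fun h => ?_⟩
  · rw [one_div, ← div_eq_inv_mul, le_div_iff₀ hn']
    linarith [re_trace_conjTranspose_mul_self_nonneg D]
  · have hzero : RCLike.re (Dᴴ * D).trace = 0 := by
      rw [hre, ← h]
      field_simp
      ring
    have hSK : S = (n : 𝕜) • K := sub_eq_zero.1 (eq_zero_of_re_trace_conjTranspose_mul_self hzero)
    rw [hSK, Matrix.mul_smul, Matrix.smul_mul, hKinv V]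
  · have htr : (S * S).trace = ((n ^ 2 : ℝ) : 𝕜) * (K * K).trace := by
      rw [htrS S h, Matrix.trace_mul_comm S K, htrS K hKinv]
      push_cast
      ring
    rw [htr, RCLike.re_ofReal_mul]
    field_simp

end
end

section
/- For positive integers l ≤ m, the squared Hilbert–Schmidt norm of the 2-coherence tensor is tr(K_{2,l,m}²) = l⁴/m² + l²(m−l)²/(d_𝔽(m)·m²). -/
open Matrix MeasureTheory
open scoped Kronecker

noncomputable section

variable {𝕜 : Type*} [RCLike 𝕜]

attribute [local instance] Matrix.frobeniusNormedAddCommGroup Matrix.frobeniusNormedSpace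

/-- A measurable function that is bounded in norm. -/
structure BoundedMeasurable {α : Type*} [MeasurableSpace α] (f : α → 𝕜) : Prop where
  measurable : Measurable f
  bounded : ∃ C : ℝ, ∀ x, ‖f x‖ ≤ C

namespace BoundedMeasurable

variable {α : Type*} [MeasurableSpace α] {f g : α → 𝕜}

lemma const (c : 𝕜) : BoundedMeasurable (fun _ : α => c) :=
  ⟨measurable_const, ‖c‖, fun _ => le_rfl⟩

lemma add (hf : BoundedMeasurable f) (hg : BoundedMeasurable g) :
    BoundedMeasurable (fun x => f x + g x) := by
  obtain ⟨C, hC⟩ := hf.bounded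
  obtain ⟨D, hD⟩ := hg.bounded
  exact ⟨hf.measurable.add hg.measurable, C + D,
    fun x => (norm_add_le _ _).trans (add_le_add (hC x) (hD x))⟩

lemma mul (hf : BoundedMeasurable f) (hg : BoundedMeasurable g) :
    BoundedMeasurable (fun x => f x * g x) := by
  obtain ⟨C, hC⟩ := hf.bounded
  obtain ⟨D, hD⟩ := hg.bounded
  refine ⟨hf.measurable.mul hg.measurable, C * D, fun x => ?_⟩
  rw [norm_mul]
  exact mul_le_mul (hC x) (hD x) (norm_nonneg _) ((norm_nonneg _).trans (hC x))

lemma sum {ι : Type*} (s : Finset ι) {F : ι → α → 𝕜}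
    (h : ∀ i ∈ s, BoundedMeasurable (F i)) :
    BoundedMeasurable (fun x => ∑ i ∈ s, F i x) := by
  classical
  induction s using Finset.induction_on with
  | empty => simpa using const 0
  | insert a s ha ih =>
    simp only [Finset.sum_insert ha]
    exact (h a (Finset.mem_insert_self a s)).add
      (ih fun i hi => h i (Finset.mem_insert_of_mem hi))

lemma integrable (hf : BoundedMeasurable f) (μ : Measure α) [IsFiniteMeasure μ] :
    Integrable f μ := by
  obtain ⟨C, hC⟩ := hf.bounded
  exact Integrable.of_bound hf.measurable.aestronglyMeasurable C (Filter.Eventually.of_forall hC)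

end BoundedMeasurable

/-- The conjugate `U * Q * U⋆` of a matrix by a unitary matrix. -/
def unitaryConj {m : ℕ} (Q : Matrix (Fin m) (Fin m) 𝕜) (U : Matrix.unitaryGroup (Fin m) 𝕜) :
    Matrix (Fin m) (Fin m) 𝕜 :=
  (U : Matrix (Fin m) (Fin m) 𝕜) * Q * star (U : Matrix (Fin m) (Fin m) 𝕜)

section unitaryConj

variable {m : ℕ} (Q : Matrix (Fin m) (Fin m) 𝕜)

lemma boundedMeasurable_coe (i j : Fin m) :
    BoundedMeasurable (fun U : Matrix.unitaryGroup (Fin m) 𝕜 =>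
      (U : Matrix (Fin m) (Fin m) 𝕜) i j) := by
  refine ⟨?_, 1, fun U => entry_norm_bound_of_unitary U.2 i j⟩
  have h : Measurable (fun A : Matrix (Fin m) (Fin m) 𝕜 => A i j) :=
    (measurable_pi_apply j).comp (measurable_pi_apply (X := fun _ : Fin m => Fin m → 𝕜) i)
  exact h.comp measurable_subtype_coe

lemma boundedMeasurable_star_coe (i j : Fin m) :
    BoundedMeasurable (fun U : Matrix.unitaryGroup (Fin m) 𝕜 =>
      (star (U : Matrix (Fin m) (Fin m) 𝕜)) i j) := by
  obtain ⟨h, C, hC⟩ := boundedMeasurable_coe (𝕜 := 𝕜) j i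
  refine ⟨?_, C, fun U => ?_⟩
  · simp only [star_apply]
    exact RCLike.continuous_conj.measurable.comp h
  · simpa [star_apply] using hC U

lemma boundedMeasurable_unitaryConj (i j : Fin m) :
    BoundedMeasurable (fun U => unitaryConj Q U i j) := by
  simp only [unitaryConj, mul_apply]
  exact .sum _ fun k _ => .mul (.sum _ fun k' _ => .mul (boundedMeasurable_coe _ _) (.const _))
    (boundedMeasurable_star_coe _ _)

lemma boundedMeasurable_trace_unitaryConj_mul (A : Matrix (Fin m) (Fin m) 𝕜) :
    BoundedMeasurable (fun U => (unitaryConj Q U * A).trace) := by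
  simp only [trace, diag_apply, mul_apply]
  exact .sum _ fun i _ => .sum _ fun j _ => .mul (boundedMeasurable_unitaryConj Q i j) (.const _)

lemma measurable_unitaryGroup_mul_left (V : Matrix.unitaryGroup (Fin m) 𝕜) :
    Measurable (fun U => V * U) := by
  refine Measurable.subtype_mk (f := fun U : Matrix.unitaryGroup (Fin m) 𝕜 =>
    (V : Matrix (Fin m) (Fin m) 𝕜) * (U : Matrix (Fin m) (Fin m) 𝕜)) ?_
  refine measurable_pi_lambda _ fun i => measurable_pi_lambda _ fun j => ?_
  simp only [mul_apply]
  exact (BoundedMeasurable.sum _ fun k _ =>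
    .mul (.const _) (boundedMeasurable_coe (𝕜 := 𝕜) k j)).measurable

lemma unitaryConj_mul (V U : Matrix.unitaryGroup (Fin m) 𝕜) :
    unitaryConj Q (V * U) = unitaryConj (unitaryConj Q U) V := by
  simp [unitaryConj, Matrix.mul_assoc]

lemma trace_unitaryConj (U : Matrix.unitaryGroup (Fin m) 𝕜) :
    (unitaryConj Q U).trace = Q.trace := by
  rw [unitaryConj, trace_mul_cycle, Unitary.coe_star_mul_self, Matrix.one_mul]

lemma unitaryConj_mul_unitaryConj (A : Matrix (Fin m) (Fin m) 𝕜)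
    (U : Matrix.unitaryGroup (Fin m) 𝕜) :
    unitaryConj Q U * unitaryConj A U = unitaryConj (Q * A) U := by
  have h : star (U : Matrix (Fin m) (Fin m) 𝕜) * (U : Matrix (Fin m) (Fin m) 𝕜) = 1 :=
    Unitary.coe_star_mul_self U
  calc _ = (U : Matrix (Fin m) (Fin m) 𝕜) * Q *
        (star (U : Matrix (Fin m) (Fin m) 𝕜) * (U : Matrix (Fin m) (Fin m) 𝕜)) * A *
          star (U : Matrix (Fin m) (Fin m) 𝕜) := by
        simp only [unitaryConj, Matrix.mul_assoc]
    _ = _ := by rw [h, Matrix.mul_one]; simp only [unitaryConj, Matrix.mul_assoc]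

lemma unitaryConj_inv_unitaryConj (U : Matrix.unitaryGroup (Fin m) 𝕜) :
    unitaryConj (unitaryConj Q U) U⁻¹ = Q := by
  rw [← unitaryConj_mul, inv_mul_cancel]
  simp [unitaryConj]

lemma trace_unitaryConj_mul_unitaryConj (A : Matrix (Fin m) (Fin m) 𝕜)
    (U V : Matrix.unitaryGroup (Fin m) 𝕜) :
    (unitaryConj Q U * unitaryConj A V).trace = (unitaryConj Q (V⁻¹ * U) * A).trace := by
  rw [← trace_unitaryConj _ V⁻¹, ← unitaryConj_mul_unitaryConj, unitaryConj_inv_unitaryConj,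
    unitaryConj_mul]

lemma isHermitian_unitaryConj {Q : Matrix (Fin m) (Fin m) 𝕜} (hQ : Q.IsHermitian)
    (U : Matrix.unitaryGroup (Fin m) 𝕜) : (unitaryConj Q U).IsHermitian := by
  simpa [unitaryConj, star_eq_conjTranspose] using
    isHermitian_mul_mul_conjTranspose (U : Matrix (Fin m) (Fin m) 𝕜) hQ

end unitaryConj

/-- A permutation matrix as an element of the unitary group. -/
def permUnitary (𝕜 : Type*) [RCLike 𝕜] {m : ℕ} (σ : Equiv.Perm (Fin m)) :
    Matrix.unitaryGroup (Fin m) 𝕜 :=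
  ⟨σ.permMatrix 𝕜, by
    rw [mem_unitaryGroup_iff, star_eq_conjTranspose, conjTranspose_permMatrix, ← permMatrix_mul,
      inv_mul_cancel, permMatrix_one]⟩

lemma unitaryConj_permUnitary_apply {m : ℕ} (Q : Matrix (Fin m) (Fin m) 𝕜)
    (σ : Equiv.Perm (Fin m)) (i j : Fin m) :
    unitaryConj Q (permUnitary 𝕜 σ) i j = Q (σ i) (σ j) := by
  simp [unitaryConj, permUnitary, star_eq_conjTranspose, PEquiv.toMatrix_toPEquiv_mul,
    PEquiv.mul_toMatrix_toPEquiv, Equiv.Perm.inv_def]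

lemma trace_eq_rank_of_mul_self_s7 {m : ℕ} (Q : Matrix (Fin m) (Fin m) 𝕜) (h : Q * Q = Q) :
    Q.trace = (Q.rank : 𝕜) := by
  have hid : IsIdempotentElem (toLin' Q) := by
    rw [IsIdempotentElem, Module.End.mul_eq_comp, ← toLin'_mul, h]
  rw [← trace_toLin'_eq, (LinearMap.IsIdempotentElem.isProj_range _ hid).trace]
  rfl

section secondMoment

variable {m : ℕ} (Q : Matrix (Fin m) (Fin m) 𝕜) (μ : Measure (Matrix.unitaryGroup (Fin m) 𝕜))

/-- The mean of `tr (U Q U⋆ A) ^ 2`. -/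
def secondMoment (A : Matrix (Fin m) (Fin m) 𝕜) : 𝕜 :=
  ∫ U, (unitaryConj Q U * A).trace * (unitaryConj Q U * A).trace ∂μ

variable {μ}

lemma integral_mul_left_unitaryGroup
    (hinv : ∀ V : Matrix.unitaryGroup (Fin m) 𝕜, Measure.map (fun U => V * U) μ = μ)
    {f : Matrix.unitaryGroup (Fin m) 𝕜 → 𝕜} (hf : BoundedMeasurable f)
    (V : Matrix.unitaryGroup (Fin m) 𝕜) : ∫ U, f (V * U) ∂μ = ∫ U, f U ∂μ := by
  conv_rhs => rw [← hinv V]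
  rw [integral_map (measurable_unitaryGroup_mul_left V).aemeasurable
    hf.measurable.aestronglyMeasurable]

lemma secondMoment_unitaryConj
    (hinv : ∀ V : Matrix.unitaryGroup (Fin m) 𝕜, Measure.map (fun U => V * U) μ = μ)
    (A : Matrix (Fin m) (Fin m) 𝕜) (V : Matrix.unitaryGroup (Fin m) 𝕜) :
    secondMoment Q μ (unitaryConj A V) = secondMoment Q μ A := by
  have hb := boundedMeasurable_trace_unitaryConj_mul Q A
  simp only [secondMoment, trace_unitaryConj_mul_unitaryConj]
  exact integral_mul_left_unitaryGroup hinv (hb.mul hb) V⁻¹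

lemma exists_integral_diag_mul_diag
    (hinv : ∀ V : Matrix.unitaryGroup (Fin m) 𝕜, Measure.map (fun U => V * U) μ = μ) :
    ∃ α β : 𝕜, ∀ i j, ∫ U, unitaryConj Q U i i * unitaryConj Q U j j ∂μ =
      (if i = j then α else 0) + β := by
  set b : Fin m → Fin m → 𝕜 := fun i j => ∫ U, unitaryConj Q U i i * unitaryConj Q U j j ∂μ
  have hperm (σ : Equiv.Perm (Fin m)) (i j : Fin m) : b (σ i) (σ j) = b i j := by
    change ∫ U, unitaryConj Q U (σ i) (σ i) * unitaryConj Q U (σ j) (σ j) ∂μ =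
      ∫ U, unitaryConj Q U i i * unitaryConj Q U j j ∂μ
    rw [← integral_mul_left_unitaryGroup hinv ((boundedMeasurable_unitaryConj Q i i).mul
      (boundedMeasurable_unitaryConj Q j j)) (permUnitary 𝕜 σ)]
    simp only [unitaryConj_mul, unitaryConj_permUnitary_apply]
  have htrans : ∀ {i j k l : Fin m}, i ≠ j → k ≠ l → b i j = b k l := by
    intro i j k l hij hkl
    obtain ⟨σ, rfl, rfl⟩ := MulAction.is_two_pretransitive_iff.mp
      (Equiv.Perm.isMultiplyPretransitive (Fin m) 2) hij hkl
    exact (hperm σ i j).symm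
  have hdiag (i j : Fin m) : b i i = b j j := by
    simpa using (hperm (Equiv.swap i j) i i).symm
  change ∃ α β : 𝕜, ∀ i j, b i j = (if i = j then α else 0) + β
  by_cases h : ∃ i j : Fin m, i ≠ j
  · obtain ⟨i₀, j₀, h₀⟩ := h
    refine ⟨b i₀ i₀ - b i₀ j₀, b i₀ j₀, fun i j => ?_⟩
    split_ifs with hij
    · rw [hij, hdiag j i₀]; ring
    · rw [htrans hij h₀]; ring
  · push Not at h
    rcases isEmpty_or_nonempty (Fin m) with hm | ⟨⟨i₀⟩⟩
    · exact ⟨0, 0, fun i => hm.elim i⟩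
    · refine ⟨b i₀ i₀, 0, fun i j => ?_⟩
      rw [h i i₀, h j i₀]
      simp

variable [IsProbabilityMeasure μ]

lemma secondMoment_diagonal {α β : 𝕜}
    (h : ∀ i j, ∫ U, unitaryConj Q U i i * unitaryConj Q U j j ∂μ =
      (if i = j then α else 0) + β) (d : Fin m → 𝕜) :
    secondMoment Q μ (diagonal d) = α * ∑ i, d i * d i + β * ((∑ i, d i) * ∑ i, d i) := by
  have hexp (U) : (unitaryConj Q U * diagonal d).trace * (unitaryConj Q U * diagonal d).trace =
      ∑ i, ∑ j, d i * d j * (unitaryConj Q U i i * unitaryConj Q U j j) := by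
    simp only [trace, diag_apply, mul_diagonal, Finset.sum_mul_sum]
    exact Finset.sum_congr rfl fun i _ => Finset.sum_congr rfl fun j _ => by ring
  have hint (i j : Fin m) : Integrable
      (fun U => d i * d j * (unitaryConj Q U i i * unitaryConj Q U j j)) μ :=
    (BoundedMeasurable.mul (.const _) (.mul (boundedMeasurable_unitaryConj Q i i)
      (boundedMeasurable_unitaryConj Q j j))).integrable μ
  simp only [secondMoment, hexp]
  rw [integral_finsetSum _ fun i _ => integrable_finsetSum _ fun j _ => hint i j]
  rw [Finset.sum_mul_sum]
  simp only [integral_finsetSum _ fun j _ => hint _ j, integral_const_mul, h, mul_add,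
    Finset.sum_add_distrib, mul_ite, mul_zero, Finset.sum_ite_eq, Finset.mem_univ, if_true,
    Finset.mul_sum]
  congr 1
  · exact Finset.sum_congr rfl fun i _ => by ring
  · exact Finset.sum_congr rfl fun i _ => Finset.sum_congr rfl fun j _ => by ring

lemma secondMoment_of_isHermitian
    (hinv : ∀ V : Matrix.unitaryGroup (Fin m) 𝕜, Measure.map (fun U => V * U) μ = μ)
    {α β : 𝕜} (h : ∀ i j, ∫ U, unitaryConj Q U i i * unitaryConj Q U j j ∂μ =
      (if i = j then α else 0) + β) {A : Matrix (Fin m) (Fin m) 𝕜} (hA : A.IsHermitian) :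
    secondMoment Q μ A = α * (A * A).trace + β * (A.trace * A.trace) := by
  obtain ⟨V, d, rfl⟩ : ∃ (V : Matrix.unitaryGroup (Fin m) 𝕜) (d : Fin m → 𝕜),
      A = unitaryConj (diagonal d) V :=
    ⟨hA.eigenvectorUnitary, RCLike.ofReal ∘ hA.eigenvalues, hA.spectral_theorem⟩
  rw [secondMoment_unitaryConj Q hinv, secondMoment_diagonal Q h, unitaryConj_mul_unitaryConj,
    trace_unitaryConj, trace_unitaryConj, diagonal_mul_diagonal, trace_diagonal, trace_diagonal]

lemma integral_mul_transpose_of_ne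
    (hinv : ∀ V : Matrix.unitaryGroup (Fin m) 𝕜, Measure.map (fun U => V * U) μ = μ)
    (hQ : Q.IsHermitian) {α β : 𝕜}
    (h : ∀ i j, ∫ U, unitaryConj Q U i i * unitaryConj Q U j j ∂μ =
      (if i = j then α else 0) + β) {c : 𝕜} (hc : c = if (RCLike.I : 𝕜) = 0 then 2 else 1)
    {i j : Fin m} (hij : i ≠ j) :
    c * ∫ U, unitaryConj Q U i j * unitaryConj Q U j i ∂μ = α := by
  have hb (a b : 𝕜) : BoundedMeasurable
      (fun U => a * unitaryConj Q U j i + b * unitaryConj Q U i j) :=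
    .add (.mul (.const _) (boundedMeasurable_unitaryConj Q j i))
      (.mul (.const _) (boundedMeasurable_unitaryConj Q i j))
  have key (a b : 𝕜) (hab : star a = b) :
      ∫ U, (a * unitaryConj Q U j i + b * unitaryConj Q U i j) *
        (a * unitaryConj Q U j i + b * unitaryConj Q U i j) ∂μ = 2 * (a * b) * α := by
    have hA : (single i j a + single j i b).IsHermitian := by
      rw [IsHermitian, conjTranspose_add, conjTranspose_single, conjTranspose_single, ← hab,
        star_star, add_comm]
    have := secondMoment_of_isHermitian Q hinv h hA
    have htr : (single i j a + single j i b).trace = 0 := by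
      rw [trace_add, trace_single_eq_of_ne _ _ _ hij, trace_single_eq_of_ne _ _ _ hij.symm,
        add_zero]
    have hsq : ((single i j a + single j i b) * (single i j a + single j i b)).trace =
        2 * (a * b) := by
      simp [Matrix.mul_add, Matrix.add_mul, hij, hij.symm]
      ring
    rw [htr, hsq] at this
    rw [show 2 * (a * b) * α = α * (2 * (a * b)) + β * (0 * 0) by ring, ← this, secondMoment]
    congr 1
    ext U
    simp [Matrix.mul_add, trace_mul_single, mul_comm]
  have h1 := key 1 1 (star_one _)
  simp only [one_mul] at h1
  by_cases hI : (RCLike.I : 𝕜) = 0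
  · have hsymm (U) : unitaryConj Q U j i = unitaryConj Q U i j := by
      rw [← (isHermitian_unitaryConj hQ U).apply j i]
      conv_rhs => rw [← RCLike.re_add_im (unitaryConj Q U i j), hI, mul_zero, add_zero]
      rw [← RCLike.re_add_im (unitaryConj Q U i j), hI, mul_zero, add_zero]
      simp
    rw [if_pos hI] at hc
    have h2 : ∫ U, (unitaryConj Q U j i + unitaryConj Q U i j) *
        (unitaryConj Q U j i + unitaryConj Q U i j) ∂μ =
        4 * ∫ U, unitaryConj Q U i j * unitaryConj Q U j i ∂μ := by
      rw [← integral_const_mul]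
      congr 1
      ext U
      rw [hsymm]
      ring
    rw [h2] at h1
    rw [hc]
    linear_combination h1 / 2
  · have hII : (RCLike.I : 𝕜) * RCLike.I = -1 := (RCLike.I_mul_I (K := 𝕜)).resolve_left hI
    rw [if_neg hI] at hc
    have h2 := key RCLike.I (-RCLike.I) (by simp)
    have hb1 := hb 1 1
    simp only [one_mul] at hb1
    have h3 := integral_add ((hb1.mul hb1).integrable μ)
      (((hb RCLike.I (-RCLike.I)).mul (hb RCLike.I (-RCLike.I))).integrable μ)
    rw [h1, h2] at h3
    have h4 : ∫ U, ((unitaryConj Q U j i + unitaryConj Q U i j) *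
        (unitaryConj Q U j i + unitaryConj Q U i j) +
        (RCLike.I * unitaryConj Q U j i + -RCLike.I * unitaryConj Q U i j) *
        (RCLike.I * unitaryConj Q U j i + -RCLike.I * unitaryConj Q U i j)) ∂μ =
        4 * ∫ U, unitaryConj Q U i j * unitaryConj Q U j i ∂μ := by
      rw [← integral_const_mul]
      congr 1
      ext U
      linear_combination (unitaryConj Q U j i - unitaryConj Q U i j) ^ 2 * hII
    rw [h4] at h3
    rw [hc]
    linear_combination h3 / 4 - α / 2 * hII

lemma sum_integral_mul_transpose (hQ : Q * Q = Q) :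
    ∑ i, ∑ j, ∫ U, unitaryConj Q U i j * unitaryConj Q U j i ∂μ = Q.trace := by
  have hint (i j : Fin m) : Integrable
      (fun U => unitaryConj Q U i j * unitaryConj Q U j i) μ :=
    ((boundedMeasurable_unitaryConj Q i j).mul (boundedMeasurable_unitaryConj Q j i)).integrable μ
  simp only [← integral_finsetSum _ fun j _ => hint _ j]
  rw [← integral_finsetSum _ fun i _ => integrable_finsetSum _ fun j _ => hint i j]
  have htr (U) : ∑ i, ∑ j, unitaryConj Q U i j * unitaryConj Q U j i = Q.trace := by
    rw [← trace_unitaryConj Q U]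
    conv_rhs => rw [← hQ, ← unitaryConj_mul_unitaryConj]
    simp only [trace, diag_apply, mul_apply]
  simp [htr]

end secondMoment

lemma dF_add_one {m : ℕ} (hm : 1 ≤ m) {c : 𝕜}
    (hc : c = if (RCLike.I : 𝕜) = 0 then 2 else 1) :
    c * ((dF 𝕜 m : 𝕜) + 1) = (m : 𝕜) ^ 2 + (c - 1) * m := by
  obtain ⟨n, rfl⟩ := Nat.exists_eq_add_of_le' hm
  by_cases hI : (RCLike.I : 𝕜) = 0
  · rw [if_pos hI] at hc
    have h2 : 2 * dF 𝕜 (n + 1) = (n + 3) * n := by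
      rw [dF, if_pos hI, Nat.mul_div_cancel']
      · simp
      · have : Even ((n + 3) * n) := by
          rw [Nat.even_mul, Nat.even_add_one.trans (not_congr Nat.even_add_one)]
          by_cases h : Even n <;> simp [h, Nat.even_add_one]
        simpa using this.two_dvd
    have h3 : (2 : 𝕜) * (dF 𝕜 (n + 1) : 𝕜) = ((n : 𝕜) + 3) * n := by exact_mod_cast h2
    rw [hc]
    push_cast
    linear_combination h3
  · rw [if_neg hI] at hc
    have h2 : dF 𝕜 (n + 1) + 1 = (n + 1) ^ 2 := by
      rw [dF, if_neg hI]
      exact Nat.sub_add_cancel (Nat.one_le_pow _ _ n.succ_pos)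
    have h3 : (dF 𝕜 (n + 1) : 𝕜) + 1 = ((n : 𝕜) + 1) ^ 2 := by exact_mod_cast h2
    rw [hc]
    push_cast
    linear_combination h3

lemma secondMoment_self {l m : ℕ} (hl : 1 ≤ l) (hlm : l ≤ m)
    {Q : Matrix (Fin m) (Fin m) 𝕜} (hQ : Q.IsHermitian) (hQQ : Q * Q = Q) (hrank : Q.rank = l)
    {μ : Measure (Matrix.unitaryGroup (Fin m) 𝕜)} [IsProbabilityMeasure μ]
    (hinv : ∀ V : Matrix.unitaryGroup (Fin m) 𝕜, Measure.map (fun U => V * U) μ = μ) :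
    secondMoment Q μ Q = (l : 𝕜) ^ 4 / (m : 𝕜) ^ 2 +
      (l : 𝕜) ^ 2 * ((m : 𝕜) - l) ^ 2 / ((dF 𝕜 m : 𝕜) * (m : 𝕜) ^ 2) := by
  have htr : Q.trace = (l : 𝕜) := by rw [trace_eq_rank_of_mul_self_s7 Q hQQ, hrank]
  obtain ⟨α, β, h⟩ := exists_integral_diag_mul_diag Q hinv
  obtain ⟨c, hc⟩ : ∃ c : 𝕜, c = if (RCLike.I : 𝕜) = 0 then 2 else 1 := ⟨_, rfl⟩
  have hc0 : c ≠ 0 := by rw [hc]; split_ifs <;> simp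
  have hl0 : (l : 𝕜) ≠ 0 := by exact_mod_cast (by omega : l ≠ 0)
  have hm0 : (m : 𝕜) ≠ 0 := by exact_mod_cast (by omega : m ≠ 0)
  have hd := dF_add_one (𝕜 := 𝕜) (hl.trans hlm) hc
  set d : 𝕜 := (dF 𝕜 m : 𝕜)
  have h1 : α * m + β * m ^ 2 = (l : 𝕜) ^ 2 := by
    have := secondMoment_of_isHermitian Q hinv h isHermitian_one
    simp only [secondMoment, Matrix.mul_one, trace_unitaryConj, htr, integral_const, probReal_univ,
      one_smul, trace_one, Fintype.card_fin] at this
    linear_combination -this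
  have h2 : c * (m * (α + β)) + m * (m - 1) * α = c * (l : 𝕜) := by
    have hent (i j : Fin m) : c * ∫ U, unitaryConj Q U i j * unitaryConj Q U j i ∂μ =
        α + if i = j then c * (α + β) - α else 0 := by
      split_ifs with hij
      · subst hij
        rw [h i i, if_pos rfl]
        ring
      · rw [integral_mul_transpose_of_ne Q hinv hQ h hc hij, add_zero]
    rw [← htr, ← sum_integral_mul_transpose (μ := μ) Q hQQ, Finset.mul_sum]
    simp only [Finset.mul_sum, hent, Finset.sum_add_distrib, Finset.sum_const, Finset.card_univ,
      Fintype.card_fin, Finset.sum_ite_eq, Finset.mem_univ, if_true, nsmul_eq_mul]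
    ring
  have h3 : (d + 1) * α + m * β = (l : 𝕜) := by
    refine mul_left_cancel₀ hc0 ?_
    linear_combination h2 + α * hd
  have h4 : α * m * d = (l : 𝕜) * (m - l) := by
    linear_combination m * h3 - h1
  have h5 : secondMoment Q μ Q = α * l + β * l ^ 2 := by
    rw [secondMoment_of_isHermitian Q hinv h hQ, hQQ, htr, sq]
  rw [h5]
  by_cases hd0 : d = 0
  · rw [hd0, mul_zero] at h4
    have hml : (m : 𝕜) = l := by
      rcases mul_eq_zero.mp h4.symm with h | h
      · exact absurd h hl0
      · exact sub_eq_zero.mp h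
    rw [hml] at h1 ⊢
    rw [h1]
    field_simp
    simp
  · field_simp
    linear_combination (d * l) * h1 + (m - l) * h4

lemma map_integral_sum_smul {E ι α : Type*} [NormedAddCommGroup E] [NormedSpace ℝ E]
    [NormedSpace 𝕜 E] [FiniteDimensional 𝕜 E] [Fintype ι] [MeasurableSpace α] {μ : Measure α}
    {f : ι → α → 𝕜} (hf : ∀ i, Integrable (f i) μ) (e : ι → E) (L : E →ₗ[𝕜] 𝕜) :
    L (∫ x, ∑ i, f i x • e i ∂μ) = ∫ x, L (∑ i, f i x • e i) ∂μ := by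
  have : CompleteSpace E := FiniteDimensional.complete 𝕜 E
  exact ((LinearMap.toContinuousLinearMap L).integral_comp_comm
    (integrable_finsetSum _ fun i _ => (hf i).smul_const (e i))).symm

lemma trace_mul_integral {ι α : Type*} [Fintype ι] [MeasurableSpace α] {μ : Measure α}
    {F : α → Matrix ι ι 𝕜} (hF : ∀ i j, Integrable (fun x => F x i j) μ) (M : Matrix ι ι 𝕜) :
    (M * ∫ x, F x ∂μ).trace = ∫ x, (M * F x).trace ∂μ := by
  classical
  have hsum : F = fun x => ∑ p : ι × ι, F x p.1 p.2 • (single p.1 p.2 1 : Matrix ι ι 𝕜) := by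
    ext1 x
    conv_lhs => rw [matrix_eq_sum_single (F x)]
    simp [smul_single, Fintype.sum_prod_type]
  have := map_integral_sum_smul (f := fun (p : ι × ι) x => F x p.1 p.2) (fun p => hF p.1 p.2)
    (fun p => (single p.1 p.2 1 : Matrix ι ι 𝕜))
    (traceLinearMap ι 𝕜 𝕜 ∘ₗ LinearMap.mulLeft 𝕜 M)
  rw [hsum]
  exact this

theorem stmt7 {l m : ℕ} (hl : 1 ≤ l) (hlm : l ≤ m)
    -- a fixed rank-`l` orthogonal projection
    (Q : Matrix (Fin m) (Fin m) 𝕜) (hQ : Q.IsHermitian ∧ Q * Q = Q ∧ Q.rank = l)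
    -- `μ` is the normalized Haar measure on the unitary (orthogonal) group
    (μ : Measure (Matrix.unitaryGroup (Fin m) 𝕜)) [IsProbabilityMeasure μ]
    (hinv : ∀ V : Matrix.unitaryGroup (Fin m) 𝕜,
      Measure.map (fun U => V * U) μ = μ)
    -- the `2`-coherence tensor `K_{2,l,m}`
    (K : Matrix (Fin m × Fin m) (Fin m × Fin m) 𝕜)
    (hK : K = ∫ U : Matrix.unitaryGroup (Fin m) 𝕜,
      (((U : Matrix (Fin m) (Fin m) 𝕜) * Q * star (U : Matrix (Fin m) (Fin m) 𝕜)) ⊗ₖ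
        ((U : Matrix (Fin m) (Fin m) 𝕜) * Q * star (U : Matrix (Fin m) (Fin m) 𝕜))) ∂μ) :
    (K * K).trace =
      ((((l : ℝ) ^ 4 / (m : ℝ) ^ 2 +
        (l : ℝ) ^ 2 * ((m : ℝ) - (l : ℝ)) ^ 2 / ((dF 𝕜 m : ℝ) * (m : ℝ) ^ 2)) : ℝ) : 𝕜) := by
  obtain ⟨hH, hQQ, hrank⟩ := hQ
  change K = ∫ U, unitaryConj Q U ⊗ₖ unitaryConj Q U ∂μ at hK
  have hint (i j : Fin m × Fin m) :
      Integrable (fun U => (unitaryConj Q U ⊗ₖ unitaryConj Q U) i j) μ :=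
    ((boundedMeasurable_unitaryConj Q i.1 j.1).mul
      (boundedMeasurable_unitaryConj Q i.2 j.2)).integrable μ
  have hU (V : Matrix.unitaryGroup (Fin m) 𝕜) :
      (K * (unitaryConj Q V ⊗ₖ unitaryConj Q V)).trace = secondMoment Q μ Q := by
    rw [trace_mul_comm, hK, trace_mul_integral hint, ← secondMoment_unitaryConj Q hinv Q V]
    simp only [← mul_kronecker_mul, trace_kronecker, secondMoment,
      trace_mul_comm (unitaryConj Q V)]
  have hKK : (K * K).trace = secondMoment Q μ Q := by
    nth_rewrite 2 [hK]
    rw [trace_mul_integral hint]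
    simp [hU]
  rw [hKK, secondMoment_self hl hlm hH hQQ hrank hinv]
  push_cast
  rfl

end
end

section
/- Let {B_k}_{k∈K} be a set of mutually unbiased bases of 𝔽^m with |K| = k_𝔽(m), where B_k = {b_1^{(k)}, …, b_m^{(k)}}. Then the family of rank-one projections F = { b_j^{(k)} (b_j^{(k)})* : k ∈ K, j ∈ {1,…,m} } is a Grassmannian 2-design; that is, ∑_{k,j} (b_j^{(k)} (b_j^{(k)})*)^{⊗2} = ∑_{k,j} (U b_j^{(k)} (b_j^{(k)})* U*)^{⊗2} for every unitary (orthogonal if 𝔽 = ℝ) m×m matrix U. -/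
open Matrix
open scoped Kronecker

noncomputable section

variable {𝕜 : Type*} [RCLike 𝕜]

/-- The rank-one tensor `v ⊗ v̄ ⊗ v ⊗ v̄`, with entries listed in the order of the entries of
`(v v*) ⊗ (v v*)`. -/
def projTensor {n : Type*} (v : n → 𝕜) : EuclideanSpace 𝕜 (n × n × n × n) :=
  WithLp.toLp 2 fun p => v p.1 * star (v p.2.1) * (v p.2.2.1 * star (v p.2.2.2))

/-- The combination `δ_{ab} δ_{cd} + δ_{ad} δ_{bc} + ε δ_{ac} δ_{bd}` of pairing tensors. -/
def pairingTensor (𝕜 : Type*) [RCLike 𝕜] (n : Type*) [DecidableEq n] (ε : ℝ) :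
    EuclideanSpace 𝕜 (n × n × n × n) :=
  WithLp.toLp 2 fun p =>
    (if p.1 = p.2.1 then 1 else 0) * (if p.2.2.1 = p.2.2.2 then 1 else 0) +
      (if p.1 = p.2.2.2 then 1 else 0) * (if p.2.1 = p.2.2.1 then 1 else 0) +
      (ε : 𝕜) * ((if p.1 = p.2.2.1 then 1 else 0) * (if p.2.1 = p.2.2.2 then 1 else 0))

lemma inner_projTensor {n : Type*} [Fintype n] (v w : n → 𝕜) :
    inner 𝕜 (projTensor v) (projTensor w) = ((‖star v ⬝ᵥ w‖ ^ 4 : ℝ) : 𝕜) := by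
  have h : ((‖star v ⬝ᵥ w‖ ^ 4 : ℝ) : 𝕜) =
      (star v ⬝ᵥ w) * star (star v ⬝ᵥ w) * ((star v ⬝ᵥ w) * star (star v ⬝ᵥ w)) := by
    have h2 := RCLike.mul_conj (star v ⬝ᵥ w)
    rw [starRingEnd_apply] at h2
    rw [h2]
    push_cast
    ring
  rw [h]
  simp only [projTensor, PiLp.inner_apply, RCLike.inner_apply, Fintype.sum_prod_type, dotProduct,
    star_sum, Finset.sum_mul_sum, starRingEnd_apply]
  refine Finset.sum_congr rfl fun a _ => ?_
  rw [Finset.sum_comm]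
  refine Finset.sum_congr rfl fun c _ => Finset.sum_congr rfl fun b _ =>
    Finset.sum_congr rfl fun d _ => ?_
  simp only [Pi.star_apply, star_mul', star_star]
  ring

lemma inner_projTensor_pairingTensor {n : Type*} [Fintype n] [DecidableEq n] (v : n → 𝕜)
    (hv : star v ⬝ᵥ v = 1) {ε : ℝ} (hε : ε = 0 ∨ ∀ x : 𝕜, star x = x) :
    inner 𝕜 (projTensor v) (pairingTensor 𝕜 n ε) = ((2 + ε : ℝ) : 𝕜) := by
  have h1 : ∑ a, ∑ b, star (v a) * v a * (star (v b) * v b) = (1 : 𝕜) := by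
    rw [← Finset.sum_mul_sum]
    simp only [dotProduct, Pi.star_apply] at hv
    rw [hv, one_mul]
  have h3 : (ε : 𝕜) * ∑ a, ∑ b, star (v a) * v b * (star (v a) * v b) = (ε : 𝕜) := by
    rcases hε with rfl | h
    · simp
    · rw [Finset.sum_congr rfl fun a _ => Finset.sum_congr rfl fun b _ =>
        show star (v a) * v b * (star (v a) * v b) = star (v a) * v a * (star (v b) * v b) by
          simp only [h]; ring, h1, mul_one]
  have h2 : ∑ a, ∑ b, star (v a) * v b * (star (v b) * v a) = (1 : 𝕜) := by
    rw [← h1]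
    exact Finset.sum_congr rfl fun a _ => Finset.sum_congr rfl fun b _ => by ring
  have h : inner 𝕜 (projTensor v) (pairingTensor 𝕜 n ε) =
      ∑ a, ∑ b, star (v a) * v a * (star (v b) * v b) +
      ∑ a, ∑ b, star (v a) * v b * (star (v b) * v a) +
      (ε : 𝕜) * ∑ a, ∑ b, star (v a) * v b * (star (v a) * v b) := by
    simp [projTensor, pairingTensor, PiLp.inner_apply, Fintype.sum_prod_type, add_mul,
      Finset.sum_add_distrib, Finset.mul_sum]
  rw [h, h1, h2, h3]
  push_cast
  ring

lemma inner_pairingTensor_self (n : Type*) [Fintype n] [DecidableEq n] (ε : ℝ) :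
    inner 𝕜 (pairingTensor 𝕜 n ε) (pairingTensor 𝕜 n ε) =
      (((2 + ε ^ 2) * (Fintype.card n : ℝ) ^ 2 + (2 + 4 * ε) * Fintype.card n : ℝ) : 𝕜) := by
  simp [pairingTensor, PiLp.inner_apply, Fintype.sum_prod_type, add_mul, mul_add,
      Finset.sum_add_distrib, apply_ite (starRingEnd 𝕜), -inner_self_eq_norm_sq_to_K]
  push_cast
  ring

/-- A family of unit vectors whose fourth-order frame potential attains the lower bound has
`∑ i, v i ⊗ v̄ i ⊗ v i ⊗ v̄ i` equal to a multiple of the pairing tensor. -/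
lemma sum_projTensor_eq {ι n : Type*} [Fintype ι] [Fintype n] [DecidableEq n] (v : ι → n → 𝕜)
    (hv : ∀ i, star (v i) ⬝ᵥ v i = 1) {ε c : ℝ} (hε : ε = 0 ∨ ∀ x : 𝕜, star x = x)
    (hpot : ∑ i, ∑ j, ‖star (v i) ⬝ᵥ v j‖ ^ 4 - 2 * (c * (2 + ε) * Fintype.card ι) +
      c ^ 2 * ((2 + ε ^ 2) * (Fintype.card n : ℝ) ^ 2 + (2 + 4 * ε) * Fintype.card n) = 0) :
    ∑ i, projTensor (v i) = (c : 𝕜) • pairingTensor 𝕜 n ε := by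
  rw [← sub_eq_zero, ← norm_eq_zero, ← sq_eq_zero_iff, @norm_sub_sq 𝕜, ← hpot]
  have hS : ‖∑ i, projTensor (v i)‖ ^ 2 = ∑ i, ∑ j, ‖star (v i) ⬝ᵥ v j‖ ^ 4 := by
    rw [← RCLike.ofReal_inj (K := 𝕜), RCLike.ofReal_pow, ← inner_self_eq_norm_sq_to_K, sum_inner]
    simp only [inner_sum, inner_projTensor]
    push_cast
    rfl
  have hT : ‖(c : 𝕜) • pairingTensor 𝕜 n ε‖ ^ 2 =
      c ^ 2 * ((2 + ε ^ 2) * (Fintype.card n : ℝ) ^ 2 + (2 + 4 * ε) * Fintype.card n) := by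
    rw [← RCLike.ofReal_inj (K := 𝕜), RCLike.ofReal_pow, ← inner_self_eq_norm_sq_to_K,
      inner_smul_left, inner_smul_right, inner_pairingTensor_self, RCLike.conj_ofReal]
    push_cast
    ring
  have hST : inner 𝕜 (∑ i, projTensor (v i)) ((c : 𝕜) • pairingTensor 𝕜 n ε) =
      ((c * (2 + ε) * Fintype.card ι : ℝ) : 𝕜) := by
    rw [sum_inner]
    simp only [inner_smul_right, inner_projTensor_pairingTensor _ (hv _) hε]
    simp
    ring
  rw [hS, hT, hST, RCLike.ofReal_re]

lemma sum_norm_dotProduct_pow_four_of_mub {K n : Type*} [Fintype K] [Fintype n] [Nonempty n]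
    [DecidableEq n] {b : K → n → n → 𝕜}
    (horth : ∀ k, ∀ j j', star (b k j) ⬝ᵥ b k j' = if j = j' then 1 else 0)
    (hmub : ∀ k k', k ≠ k' → ∀ j j',
      ‖star (b k j) ⬝ᵥ b k' j'‖ ^ 2 = 1 / (Fintype.card n : ℝ)) :
    ∑ i : K × n, ∑ i' : K × n, ‖star (b i.1 i.2) ⬝ᵥ b i'.1 i'.2‖ ^ 4 =
      (Fintype.card K : ℝ) * (Fintype.card n + Fintype.card K - 1) := by
  classical
  have hn : (Fintype.card n : ℝ) ≠ 0 := by simp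
  have h (k : K) (j : n) (k' : K) : ∑ j', ‖star (b k j) ⬝ᵥ b k' j'‖ ^ 4 =
      1 / (Fintype.card n : ℝ) + if k = k' then 1 - 1 / (Fintype.card n : ℝ) else 0 := by
    split_ifs with hk
    · subst hk
      simp [horth, apply_ite, ite_pow]
    · simp only [show ∀ x : ℝ, x ^ 4 = (x ^ 2) ^ 2 by intro x; ring, hmub k k' hk]
      simp
      field_simp
  simp only [Fintype.sum_prod_type, h]
  simp [Finset.sum_add_distrib]
  field_simp
  ring

lemma star_eq_self_of_I_eq_zero (hI : (RCLike.I : 𝕜) = 0) (x : 𝕜) : star x = x := by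
  rw [← starRingEnd_apply, RCLike.conj_eq_iff_im, RCLike.im_eq_zero hI]

lemma exists_sum_projTensor_eq_of_mub {K n : Type*} [Fintype K] [Fintype n] [Nonempty n]
    [DecidableEq n]
    (hcard : (Fintype.card K : ℝ) = (Fintype.card n : ℝ) / 2 + 1 ∧ (RCLike.I : 𝕜) = 0 ∨
      (Fintype.card K : ℝ) = (Fintype.card n : ℝ) + 1) :
    ∃ T : EuclideanSpace 𝕜 (n × n × n × n), ∀ b : K → n → n → 𝕜,
      (∀ k, ∀ j j', star (b k j) ⬝ᵥ b k j' = if j = j' then 1 else 0) →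
      (∀ k k', k ≠ k' → ∀ j j',
        ‖star (b k j) ⬝ᵥ b k' j'‖ ^ 2 = 1 / (Fintype.card n : ℝ)) →
      ∑ i : K × n, projTensor (b i.1 i.2) = T := by
  rcases hcard with ⟨hcard, hI⟩ | hcard
  · refine ⟨((1 / 2 : ℝ) : 𝕜) • pairingTensor 𝕜 n 1, fun b horth hmub =>
      sum_projTensor_eq _ (fun i => by simp [horth]) (.inr (star_eq_self_of_I_eq_zero hI)) ?_⟩
    rw [sum_norm_dotProduct_pow_four_of_mub horth hmub, Fintype.card_prod, Nat.cast_mul, hcard]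
    ring
  · refine ⟨((1 : ℝ) : 𝕜) • pairingTensor 𝕜 n 0, fun b horth hmub =>
      sum_projTensor_eq _ (fun i => by simp [horth]) (.inl rfl) ?_⟩
    rw [sum_norm_dotProduct_pow_four_of_mub horth hmub, Fintype.card_prod, Nat.cast_mul, hcard]
    ring

open scoped Classical in
theorem stmt10 {m : ℕ} (hm : 0 < m) {K : Type*} [Fintype K]
    -- a family of orthonormal bases of `𝕜^m`
    (b : K → Fin m → (Fin m → 𝕜))
    (horth : ∀ k, ∀ j j' : Fin m, star (b k j) ⬝ᵥ b k j' = if j = j' then 1 else 0)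
    -- the bases are pairwise mutually unbiased
    (hmub : ∀ k k' : K, k ≠ k' → ∀ j j' : Fin m,
      ‖star (b k j) ⬝ᵥ b k' j'‖ ^ 2 = 1 / (m : ℝ))
    -- the set of mutually unbiased bases is maximal: `|K| = k_𝔽(m)`
    (hcard : (Fintype.card K : ℝ) =
      if (RCLike.I : 𝕜) = 0 then (m : ℝ) / 2 + 1 else (m : ℝ) + 1) :
    -- the rank-one projections form a Grassmannian 2-design
    ∀ U : Matrix.unitaryGroup (Fin m) 𝕜,
      ∑ k : K, ∑ j : Fin m,
        (vecMulVec (b k j) (star (b k j))) ⊗ₖ (vecMulVec (b k j) (star (b k j))) =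
      ∑ k : K, ∑ j : Fin m,
        ((U : Matrix (Fin m) (Fin m) 𝕜) * vecMulVec (b k j) (star (b k j)) *
            star (U : Matrix (Fin m) (Fin m) 𝕜)) ⊗ₖ
          ((U : Matrix (Fin m) (Fin m) 𝕜) * vecMulVec (b k j) (star (b k j)) *
            star (U : Matrix (Fin m) (Fin m) 𝕜)) := by
  intro U
  have : Nonempty (Fin m) := ⟨⟨0, hm⟩⟩
  have hdot (v w : Fin m → 𝕜) :
      star ((U : Matrix (Fin m) (Fin m) 𝕜) *ᵥ v) ⬝ᵥ ((U : Matrix (Fin m) (Fin m) 𝕜) *ᵥ w) =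
        star v ⬝ᵥ w := by
    rw [star_mulVec, dotProduct_mulVec, vecMul_vecMul, ← star_eq_conjTranspose,
      UnitaryGroup.star_mul_self, vecMul_one]
  have hproj (v : Fin m → 𝕜) :
      (U : Matrix (Fin m) (Fin m) 𝕜) * vecMulVec v (star v) *
          star (U : Matrix (Fin m) (Fin m) 𝕜) =
        vecMulVec ((U : Matrix (Fin m) (Fin m) 𝕜) *ᵥ v)
          (star ((U : Matrix (Fin m) (Fin m) 𝕜) *ᵥ v)) := by
    rw [mul_vecMulVec, vecMulVec_mul, star_mulVec, star_eq_conjTranspose]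
  obtain ⟨T, hT⟩ := exists_sum_projTensor_eq_of_mub (𝕜 := 𝕜) (K := K) (n := Fin m) (by
    rw [Fintype.card_fin]
    split_ifs at hcard with hI
    · exact .inl ⟨hcard, hI⟩
    · exact .inr hcard)
  have hb := hT b (by convert horth) (by simpa using hmub)
  have hUb := hT (fun k j => (U : Matrix (Fin m) (Fin m) 𝕜) *ᵥ b k j)
    (by simp only [hdot]; convert horth) (by simpa [hdot] using hmub)
  simp only [hproj]
  ext ⟨a, c⟩ ⟨a', c'⟩
  have h := congrArg (fun x => x.ofLp (a, a', c, c')) (hb.trans hUb.symm)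
  simpa [projTensor, Fintype.sum_prod_type, Matrix.sum_apply, vecMulVec_apply,
    kroneckerMap_apply] using h

end
end

section
/- Let m be even, let {B_k}_{k∈K} be a maximal set of mutually unbiased bases of 𝔽^m (so |K| = k_𝔽(m)), and let 𝕊 be a collection of subsets of {1,…,m}, each of size m/2. Suppose the family F = { P_J^{(k)} : k ∈ K, J ∈ 𝕊 } of coordinate projections (P_J^{(k)} the J-coordinate projection with respect to B_k) is a (2·d_𝔽(m), m/2, m)-fusion frame. Then F is a Grassmannian 2-design if and only if 𝕊 is a 2-(m, m/2, m/2 − 1) block design. -/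
open Matrix
open scoped Kronecker

noncomputable section

variable {𝕜 : Type*} [RCLike 𝕜]

/-- a `t`-`(m,l,λ)` block design -/
def IsBlockDesign (t m l lam : ℕ) (𝕊 : Finset (Finset (Fin m))) : Prop :=
  (∀ J ∈ 𝕊, J.card = l) ∧
  ∀ T : Finset (Fin m), T.card = t → ({J ∈ 𝕊 | T ⊆ J} : Finset _).card = lam

lemma conj_eq_self_of_I_eq_zero (hI : (RCLike.I : 𝕜) = 0) (z : 𝕜) : starRingEnd 𝕜 z = z := by
  have h := RCLike.re_add_im z
  rw [hI, mul_zero, add_zero] at h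
  rw [← h, RCLike.conj_ofReal]

/-- The swap operator of `𝕜^m ⊗ 𝕜^m`. -/
def swapMatrix (𝕜 : Type*) [RCLike 𝕜] (m : ℕ) : Matrix (Fin m × Fin m) (Fin m × Fin m) 𝕜 :=
  fun p q => if p = q.swap then 1 else 0

/-- The unnormalized projection onto the maximally entangled vector of `𝕜^m ⊗ 𝕜^m`. -/
def entangledMatrix (𝕜 : Type*) [RCLike 𝕜] (m : ℕ) :
    Matrix (Fin m × Fin m) (Fin m × Fin m) 𝕜 :=
  fun p q => if p.1 = p.2 ∧ q.1 = q.2 then 1 else 0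

section Tensor

variable {m : ℕ}

lemma swapMatrix_mul (M : Matrix (Fin m × Fin m) (Fin m × Fin m) 𝕜) (p q) :
    (swapMatrix 𝕜 m * M) p q = M p.swap q := by
  have h (x : Fin m × Fin m) : p = x.swap ↔ x = p.swap := by
    rw [← Prod.swap_inj, Prod.swap_swap]; exact eq_comm
  simp [Matrix.mul_apply, swapMatrix, h]

lemma mul_swapMatrix (M : Matrix (Fin m × Fin m) (Fin m × Fin m) 𝕜) (p q) :
    (M * swapMatrix 𝕜 m) p q = M p q.swap := by
  simp [Matrix.mul_apply, swapMatrix]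

lemma swapMatrix_mul_self : swapMatrix 𝕜 m * swapMatrix 𝕜 m = 1 := by
  ext p q
  rw [swapMatrix_mul, swapMatrix, Matrix.one_apply]
  simp [Prod.swap_inj]

lemma kronecker_self_mul_swapMatrix (A : Matrix (Fin m) (Fin m) 𝕜) :
    (A ⊗ₖ A) * swapMatrix 𝕜 m = swapMatrix 𝕜 m * (A ⊗ₖ A) := by
  ext p q
  rw [swapMatrix_mul, mul_swapMatrix]
  simp [Matrix.kroneckerMap_apply, mul_comm]

lemma trace_swapMatrix_mul_kronecker (A B : Matrix (Fin m) (Fin m) 𝕜) :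
    (swapMatrix 𝕜 m * (A ⊗ₖ B)).trace = (A * B).trace := by
  simp only [Matrix.trace, Matrix.diag_apply, swapMatrix_mul]
  simp [Fintype.sum_prod_type, Matrix.mul_apply]
  rw [Finset.sum_comm]

lemma entangledMatrix_eq :
    entangledMatrix 𝕜 m =
      vecMulVec (fun p => (1 : Matrix (Fin m) (Fin m) 𝕜) p.1 p.2)
        (fun p => (1 : Matrix (Fin m) (Fin m) 𝕜) p.1 p.2) := by
  ext p q
  simp only [entangledMatrix, vecMulVec_apply, Matrix.one_apply]
  split_ifs <;> simp_all

lemma trace_entangledMatrix_mul_kronecker (A B : Matrix (Fin m) (Fin m) 𝕜) :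
    (entangledMatrix 𝕜 m * (A ⊗ₖ B)).trace = (A * Bᵀ).trace := by
  rw [entangledMatrix_eq, vecMulVec_mul, trace_vecMulVec]
  simp [dotProduct, vecMul, Fintype.sum_prod_type, Matrix.one_apply, Matrix.mul_apply,
    Matrix.trace]
  rw [Finset.sum_comm]

lemma swapMatrix_mul_entangledMatrix :
    swapMatrix 𝕜 m * entangledMatrix 𝕜 m = entangledMatrix 𝕜 m := by
  ext p q
  rw [swapMatrix_mul]
  simp [entangledMatrix, eq_comm]

lemma entangledMatrix_mul_swapMatrix :
    entangledMatrix 𝕜 m * swapMatrix 𝕜 m = entangledMatrix 𝕜 m := by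
  ext p q
  rw [mul_swapMatrix]
  simp [entangledMatrix, eq_comm]

lemma entangledMatrix_mul_self :
    entangledMatrix 𝕜 m * entangledMatrix 𝕜 m = (m : 𝕜) • entangledMatrix 𝕜 m := by
  simp only [entangledMatrix_eq]
  rw [vecMulVec_mul_vecMulVec, vecMulVec_smul]
  simp [dotProduct, Fintype.sum_prod_type, Matrix.one_apply]

lemma trace_swapMatrix : (swapMatrix 𝕜 m).trace = m := by
  have h := trace_swapMatrix_mul_kronecker (1 : Matrix (Fin m) (Fin m) 𝕜) 1
  simpa using h

lemma trace_entangledMatrix : (entangledMatrix 𝕜 m).trace = m := by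
  have h := trace_entangledMatrix_mul_kronecker (1 : Matrix (Fin m) (Fin m) 𝕜) 1
  simpa using h

lemma isHermitian_swapMatrix : (swapMatrix 𝕜 m).IsHermitian := by
  ext p q
  have h : q = p.swap ↔ p = q.swap := by
    rw [← Prod.swap_inj, Prod.swap_swap]; exact eq_comm
  simp [swapMatrix, Matrix.conjTranspose_apply, h, apply_ite]

lemma isHermitian_entangledMatrix : (entangledMatrix 𝕜 m).IsHermitian := by
  ext p q
  simp [entangledMatrix, Matrix.conjTranspose_apply, apply_ite, and_comm]

/-- The operator `1 + swap + c • entangled` on `𝕜^m ⊗ 𝕜^m`. -/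
def isotropicMatrix (𝕜 : Type*) [RCLike 𝕜] (c : ℝ) (m : ℕ) :
    Matrix (Fin m × Fin m) (Fin m × Fin m) 𝕜 :=
  1 + swapMatrix 𝕜 m + (c : 𝕜) • entangledMatrix 𝕜 m

lemma isHermitian_isotropicMatrix (c : ℝ) :
    (isotropicMatrix 𝕜 c m).IsHermitian := by
  refine (Matrix.isHermitian_one.add isHermitian_swapMatrix).add ?_
  rw [Matrix.IsHermitian, Matrix.conjTranspose_smul, isHermitian_entangledMatrix.eq]
  simp

lemma trace_isotropicMatrix_mul_self (c : ℝ) :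
    (isotropicMatrix 𝕜 c m * isotropicMatrix 𝕜 c m).trace =
      2 * (m : 𝕜) ^ 2 + 2 * m + 4 * c * m + c ^ 2 * m ^ 2 := by
  simp only [isotropicMatrix, add_mul, mul_add, one_mul, mul_one, Matrix.smul_mul,
    Matrix.mul_smul, swapMatrix_mul_self, swapMatrix_mul_entangledMatrix,
    entangledMatrix_mul_swapMatrix, entangledMatrix_mul_self, Matrix.trace_add,
    Matrix.trace_smul, trace_swapMatrix, trace_entangledMatrix, Matrix.trace_one]
  simp
  ring

lemma trace_isotropicMatrix_mul_kronecker (c : ℝ) (A B : Matrix (Fin m) (Fin m) 𝕜) :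
    (isotropicMatrix 𝕜 c m * (A ⊗ₖ B)).trace =
      A.trace * B.trace + (A * B).trace + c * (A * Bᵀ).trace := by
  simp only [isotropicMatrix, add_mul, one_mul, Matrix.smul_mul, Matrix.trace_add,
    Matrix.trace_smul, trace_swapMatrix_mul_kronecker, trace_entangledMatrix_mul_kronecker,
    Matrix.trace_kronecker, smul_eq_mul]

lemma kronecker_mul_entangledMatrix_mul (A B C D : Matrix (Fin m) (Fin m) 𝕜) (h : A * Bᵀ = 1)
    (h' : Cᵀ * D = 1) : (A ⊗ₖ B) * entangledMatrix 𝕜 m * (C ⊗ₖ D) = entangledMatrix 𝕜 m := by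
  rw [entangledMatrix_eq, mul_vecMulVec, vecMulVec_mul]
  congr 1
  · ext p
    simp only [← congrFun₂ h p.1 p.2]
    simp [mulVec, dotProduct, Fintype.sum_prod_type, Matrix.one_apply, Matrix.mul_apply]
  · ext p
    simp only [← congrFun₂ h' p.1 p.2]
    simp [vecMul, dotProduct, Fintype.sum_prod_type, Matrix.one_apply, Matrix.mul_apply]

lemma kronecker_conj_isotropicMatrix {c : ℝ} (hc : c = 0 ∨ (RCLike.I : 𝕜) = 0)
    {U : Matrix (Fin m) (Fin m) 𝕜} (hU : U * star U = 1) :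
    (U ⊗ₖ U) * isotropicMatrix 𝕜 c m * (star U ⊗ₖ star U) = isotropicMatrix 𝕜 c m := by
  have hUU : (U ⊗ₖ U) * (star U ⊗ₖ star U) = 1 := by
    rw [← Matrix.mul_kronecker_mul, hU, Matrix.one_kronecker_one]
  rw [isotropicMatrix, mul_add, mul_add, add_mul, add_mul, mul_one, hUU,
    kronecker_self_mul_swapMatrix, mul_assoc, hUU, mul_one]
  congr 1
  rcases hc with rfl | hI
  · simp
  · have hstar : star U = Uᵀ := by
      ext i j
      exact conj_eq_self_of_I_eq_zero hI _
    rw [Matrix.mul_smul, Matrix.smul_mul, kronecker_mul_entangledMatrix_mul]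
    · rw [← hstar, hU]
    · rw [hstar, Matrix.transpose_transpose, ← hstar, hU]

end Tensor

section MutuallyUnbiasedBases

variable {m : ℕ} {K : Type*}

/-- The rank-one operator `v v*`. -/
def rankOne (v : Fin m → 𝕜) : Matrix (Fin m) (Fin m) 𝕜 := vecMulVec v (star v)

lemma isHermitian_rankOne (v : Fin m → 𝕜) : (rankOne v).IsHermitian := by
  rw [rankOne, Matrix.IsHermitian, conjTranspose_vecMulVec, star_star]

lemma trace_rankOne (v : Fin m → 𝕜) : (rankOne v).trace = star v ⬝ᵥ v := by
  rw [rankOne, trace_vecMulVec, dotProduct_comm]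

lemma trace_rankOne_mul_rankOne (v w : Fin m → 𝕜) :
    (rankOne v * rankOne w).trace = ((‖star v ⬝ᵥ w‖ ^ 2 : ℝ) : 𝕜) := by
  have h : v ⬝ᵥ star w = star (star v ⬝ᵥ w) := by
    rw [star_dotProduct, star_star, dotProduct_comm]
  rw [rankOne, rankOne, vecMulVec_mul_vecMulVec, trace_vecMulVec, dotProduct_smul, h,
    smul_eq_mul, RCLike.star_def, RCLike.mul_conj]
  push_cast
  rfl

lemma rankOne_mulVec (U : Matrix (Fin m) (Fin m) 𝕜) (v : Fin m → 𝕜) :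
    rankOne (U *ᵥ v) = U * rankOne v * star U := by
  rw [rankOne, rankOne, mul_vecMulVec, vecMulVec_mul, star_mulVec, star_eq_conjTranspose]

lemma sum_rankOne_of_orthonormal {v : Fin m → Fin m → 𝕜}
    (hv : ∀ i j, star (v i) ⬝ᵥ v j = if i = j then 1 else 0) : ∑ i, rankOne (v i) = 1 := by
  set B : Matrix (Fin m) (Fin m) 𝕜 := Matrix.of fun a j => v j a with hB
  have h : Bᴴ * B = 1 := by
    ext i j
    rw [Matrix.one_apply, ← hv i j]
    rfl
  rw [← mul_eq_one_comm.1 h]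
  ext a c
  rw [Matrix.mul_apply]
  simp [hB, rankOne, Matrix.sum_apply, vecMulVec_apply]

/-- A family of pairwise mutually unbiased orthonormal bases. -/
structure IsMUBFamily (b : K → Fin m → Fin m → 𝕜) : Prop where
  orthonormal : ∀ k, ∀ j j' : Fin m, star (b k j) ⬝ᵥ b k j' = if j = j' then 1 else 0
  unbiased : ∀ k k' : K, k ≠ k' → ∀ j j' : Fin m, ‖star (b k j) ⬝ᵥ b k' j'‖ ^ 2 = 1 / (m : ℝ)

namespace IsMUBFamily

variable {b : K → Fin m → Fin m → 𝕜}

lemma trace_mul (hb : IsMUBFamily b) [DecidableEq K] (k k' : K) (i j : Fin m) :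
    (rankOne (b k i) * rankOne (b k' j)).trace =
      if k = k' then (if i = j then 1 else 0) else (m : 𝕜)⁻¹ := by
  rw [trace_rankOne_mul_rankOne]
  split_ifs with hk hij
  · subst hk hij
    simp [hb.orthonormal]
  · subst hk
    simp [hb.orthonormal, hij]
  · simp [hb.unbiased k k' hk]

variable [Fintype K]

lemma trace_sum_kronecker_mul_self (hb : IsMUBFamily b) (hm : m ≠ 0) :
    ((∑ k, ∑ i, rankOne (b k i) ⊗ₖ rankOne (b k i)) *
      ∑ k, ∑ i, rankOne (b k i) ⊗ₖ rankOne (b k i)).trace =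
      (Fintype.card K : 𝕜) * (m + Fintype.card K - 1) := by
  classical
  have hm' : (m : 𝕜) ≠ 0 := Nat.cast_ne_zero.2 hm
  have key (k : K) (i : Fin m) : ∑ k', ∑ j, ((rankOne (b k i) * rankOne (b k' j)).trace *
      (rankOne (b k i) * rankOne (b k' j)).trace) = 1 + (Fintype.card K - 1) * (m : 𝕜)⁻¹ := by
    have h (k' : K) : ∑ j, ((rankOne (b k i) * rankOne (b k' j)).trace *
        (rankOne (b k i) * rankOne (b k' j)).trace) =
        (m : 𝕜)⁻¹ + if k = k' then 1 - (m : 𝕜)⁻¹ else 0 := by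
      simp only [hb.trace_mul]
      split_ifs with hk
      · simp
      · simp [hm']
    simp only [h, Finset.sum_add_distrib, Finset.sum_ite_eq, Finset.mem_univ, if_true,
      Finset.sum_const, Finset.card_univ, nsmul_eq_mul]
    ring
  simp only [Finset.sum_mul, Matrix.trace_sum]
  simp only [Finset.mul_sum, Matrix.trace_sum, ← Matrix.mul_kronecker_mul,
    Matrix.trace_kronecker, key, Finset.sum_const, Finset.card_univ, Fintype.card_fin,
    nsmul_eq_mul]
  field_simp
  ring

open scoped ComplexOrder in
/-- A maximal family of mutually unbiased bases is a projective `2`-design. -/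
lemma smul_sum_kronecker_self (hb : IsMUBFamily b) (hm : m ≠ 0) {c : ℝ}
    (hc : c = 0 ∨ c = 1 ∧ (RCLike.I : 𝕜) = 0)
    (hK : (1 + c) * Fintype.card K = m + 1 + c) :
    (1 + c : 𝕜) • ∑ k, ∑ i, rankOne (b k i) ⊗ₖ rankOne (b k i) = isotropicMatrix 𝕜 c m := by
  classical
  set G := ∑ k, ∑ i, rankOne (b k i) ⊗ₖ rankOne (b k i) with hG
  have hGH : G.IsHermitian := by
    rw [Matrix.IsHermitian, hG]
    simp only [Matrix.conjTranspose_sum, Matrix.conjTranspose_kronecker,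
      (isHermitian_rankOne _).eq]
  have hWG : (isotropicMatrix 𝕜 c m * G).trace = Fintype.card K * m * (2 + c) := by
    have h (k : K) (i : Fin m) :
        (isotropicMatrix 𝕜 c m * (rankOne (b k i) ⊗ₖ rankOne (b k i))).trace = 2 + c := by
      rw [trace_isotropicMatrix_mul_kronecker, hb.trace_mul, trace_rankOne, hb.orthonormal]
      rcases hc with rfl | ⟨-, hI⟩
      · norm_num
      · have ht : (rankOne (b k i))ᵀ = rankOne (b k i) := by
          conv_rhs => rw [← (isHermitian_rankOne (b k i)).eq]
          ext x y
          exact (conj_eq_self_of_I_eq_zero hI _).symm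
        rw [ht, hb.trace_mul]
        norm_num
    simp only [hG, Finset.mul_sum, Matrix.trace_sum, h, Finset.sum_const, Finset.card_univ,
      Fintype.card_fin, nsmul_eq_mul]
    ring
  have hGW : (G * isotropicMatrix 𝕜 c m).trace = Fintype.card K * m * (2 + c) := by
    rw [Matrix.trace_mul_comm, hWG]
  have hGG := hb.trace_sum_kronecker_mul_self hm
  rw [← hG] at hGG
  have hK' : (1 + c : 𝕜) * Fintype.card K = m + 1 + c := by
    exact_mod_cast congrArg ((↑) : ℝ → 𝕜) hK
  have hc' : (c : 𝕜) * (1 - c) = 0 := by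
    rcases hc with rfl | ⟨rfl, -⟩ <;> simp
  rw [← sub_eq_zero, ← Matrix.trace_conjTranspose_mul_self_eq_zero_iff]
  have hH : ((1 + c : 𝕜) • G - isotropicMatrix 𝕜 c m)ᴴ =
      (1 + c : 𝕜) • G - isotropicMatrix 𝕜 c m := by
    rw [Matrix.conjTranspose_sub, Matrix.conjTranspose_smul, hGH.eq,
      (isHermitian_isotropicMatrix c).eq]
    simp
  rw [hH]
  simp only [sub_mul, mul_sub, Matrix.smul_mul, Matrix.mul_smul, Matrix.trace_sub,
    Matrix.trace_smul, hGG, hGW, hWG, trace_isotropicMatrix_mul_self, smul_eq_mul]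
  linear_combination ((1 + c : 𝕜) * (m - 1) + (1 + c) * Fintype.card K + (m + 1 + c)
    - 2 * m * (2 + c)) * hK' + (m : 𝕜) * (1 - m) * hc'

end IsMUBFamily

end MutuallyUnbiasedBases

section BlockDesign

variable {m l : ℕ}

/-- The number of blocks of `𝕊` containing both `i` and `j`. -/
def pairCount (𝕊 : Finset (Finset (Fin m))) (i j : Fin m) : ℕ :=
  ({J ∈ 𝕊 | i ∈ J ∧ j ∈ J} : Finset _).card

lemma sum_mul_sum_blocks {R : Type*} [CommSemiring R] (𝕊 : Finset (Finset (Fin m)))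
    (f g : Fin m → R) :
    ∑ J ∈ 𝕊, (∑ i ∈ J, f i) * ∑ j ∈ J, g j =
      ∑ i, ∑ j, (pairCount 𝕊 i j : R) * (f i * g j) := by
  have h (J : Finset (Fin m)) : (∑ i ∈ J, f i) * ∑ j ∈ J, g j =
      ∑ i, ∑ j, if i ∈ J ∧ j ∈ J then f i * g j else 0 := by
    have hJ (f : Fin m → R) : ∑ i ∈ J, f i = ∑ i, if i ∈ J then f i else 0 := by simp
    rw [hJ f, hJ g, Finset.sum_mul_sum]
    refine Finset.sum_congr rfl fun i _ => Finset.sum_congr rfl fun j _ => ?_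
    by_cases hi : i ∈ J <;> by_cases hj : j ∈ J <;> simp [hi, hj]
  simp only [h]
  rw [Finset.sum_comm]
  refine Finset.sum_congr rfl fun i _ => ?_
  rw [Finset.sum_comm]
  refine Finset.sum_congr rfl fun j _ => ?_
  rw [← Finset.sum_filter, Finset.sum_const, nsmul_eq_mul, pairCount]

lemma sum_pairCount {𝕊 : Finset (Finset (Fin m))} (hsize : ∀ J ∈ 𝕊, J.card = l) (i : Fin m) :
    ∑ j, pairCount 𝕊 i j = l * pairCount 𝕊 i i := by
  simp only [pairCount, Finset.card_filter]
  rw [Finset.sum_comm, Finset.mul_sum]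
  refine Finset.sum_congr rfl fun J hJ => ?_
  by_cases hi : i ∈ J <;> simp [hi, hsize J hJ]

lemma sum_pairCount_self {𝕊 : Finset (Finset (Fin m))} (hsize : ∀ J ∈ 𝕊, J.card = l) :
    ∑ i, pairCount 𝕊 i i = 𝕊.card * l := by
  simp only [pairCount, Finset.card_filter]
  rw [Finset.sum_comm, Finset.card_eq_sum_ones, Finset.sum_mul]
  refine Finset.sum_congr rfl fun J hJ => ?_
  simp [hsize J hJ]

lemma isBlockDesign_two_iff {lam : ℕ} {𝕊 : Finset (Finset (Fin m))}
    (hsize : ∀ J ∈ 𝕊, J.card = l) :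
    IsBlockDesign 2 m l lam 𝕊 ↔ ∀ i j, i ≠ j → pairCount 𝕊 i j = lam := by
  refine ⟨fun h i j hij => ?_, fun h => ⟨hsize, fun T hT => ?_⟩⟩
  · rw [← h.2 {i, j} (Finset.card_pair hij), pairCount]
    simp [Finset.insert_subset_iff]
  · obtain ⟨i, j, hij, rfl⟩ := Finset.card_eq_two.1 hT
    rw [← h i j hij, pairCount]
    simp [Finset.insert_subset_iff]

lemma pairCount_self_of_const (hl : 0 < l) (hm : m = 2 * l) {𝕊 : Finset (Finset (Fin m))}
    (hsize : ∀ J ∈ 𝕊, J.card = l) (hcard : 𝕊.card = 2 * (2 * l - 1))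
    (h : ∀ i j, i ≠ j → pairCount 𝕊 i j = l - 1) (i : Fin m) :
    pairCount 𝕊 i i = 2 * l - 1 := by
  obtain rfl | hl1 : l = 1 ∨ 1 < l := by omega
  · subst hm
    have hS : 𝕊 = Finset.powersetCard 1 Finset.univ := by
      refine Finset.eq_of_subset_of_card_le (fun J hJ => ?_) (by simp [hcard])
      exact Finset.mem_powersetCard.2 ⟨Finset.subset_univ J, hsize J hJ⟩
    rw [hS]
    fin_cases i <;> rfl
  · have hsum := sum_pairCount hsize i
    rw [← Finset.add_sum_erase _ _ (Finset.mem_univ i),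
      Finset.sum_congr rfl fun j hj => h i j (Finset.ne_of_mem_erase hj).symm] at hsum
    simp only [Finset.sum_const, Finset.card_erase_of_mem (Finset.mem_univ i), Finset.card_univ,
      Fintype.card_fin, smul_eq_mul, hm] at hsum
    obtain ⟨k, rfl⟩ : ∃ k, l = k + 2 := ⟨l - 2, by omega⟩
    have h1 : 2 * (k + 2) - 1 = 2 * k + 3 := by omega
    have h2 : k + 2 - 1 = k + 1 := by omega
    rw [h1, h2] at hsum
    rw [h1]
    exact Nat.eq_of_mul_eq_mul_left (Nat.succ_pos k) (by linarith)

lemma exists_perm_apply_eq {α : Type*} [DecidableEq α] {i j i' j' : α} (h : i ≠ j)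
    (h' : i' ≠ j') : ∃ σ : Equiv.Perm α, σ i = i' ∧ σ j = j' := by
  have h1 : i' ≠ Equiv.swap i i' j := by
    rw [ne_eq, eq_comm, Equiv.swap_apply_eq_iff, Equiv.swap_apply_right]
    exact h.symm
  refine ⟨Equiv.swap (Equiv.swap i i' j) j' * Equiv.swap i i', ?_, ?_⟩
  · rw [Equiv.Perm.mul_apply, Equiv.swap_apply_left, Equiv.swap_apply_of_ne_of_ne h1 h']
  · rw [Equiv.Perm.mul_apply, Equiv.swap_apply_left]

lemma pairCount_eq_of_perm_invariant (hl : 0 < l) (hm : m = 2 * l)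
    {𝕊 : Finset (Finset (Fin m))} (hsize : ∀ J ∈ 𝕊, J.card = l)
    (hcard : 𝕊.card = 2 * (2 * l - 1))
    (h : ∀ (σ : Equiv.Perm (Fin m)) i j, pairCount 𝕊 (σ i) (σ j) = pairCount 𝕊 i j)
    {i j : Fin m} (hij : i ≠ j) : pairCount 𝕊 i j = l - 1 := by
  have hr (j : Fin m) : pairCount 𝕊 j j = pairCount 𝕊 i i := by
    rw [← h (Equiv.swap i j) i i, Equiv.swap_apply_left]
  have hlam (j' : Fin m) (hj' : j' ∈ Finset.univ.erase i) :
      pairCount 𝕊 i j' = pairCount 𝕊 i j := by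
    obtain ⟨σ, h1, h2⟩ := exists_perm_apply_eq hij (Finset.ne_of_mem_erase hj').symm
    rw [← h σ i j, h1, h2]
  have hs1 := sum_pairCount_self hsize
  rw [Finset.sum_congr rfl fun j _ => hr j] at hs1
  have hs2 := sum_pairCount hsize i
  rw [← Finset.add_sum_erase _ _ (Finset.mem_univ i), Finset.sum_congr rfl hlam] at hs2
  simp only [Finset.sum_const, Finset.card_erase_of_mem (Finset.mem_univ i), Finset.card_univ,
    Fintype.card_fin, smul_eq_mul, hcard, hm] at hs1 hs2
  obtain ⟨k, rfl⟩ : ∃ k, l = k + 1 := ⟨l - 1, by omega⟩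
  have h1 : 2 * (k + 1) - 1 = 2 * k + 1 := by omega
  have h2 : k + 1 - 1 = k := by omega
  rw [h1] at hs1 hs2
  rw [h2]
  have hr' : pairCount 𝕊 i i = 2 * k + 1 :=
    Nat.eq_of_mul_eq_mul_left (Nat.succ_pos k) (by linarith)
  rw [hr'] at hs2
  exact Nat.eq_of_mul_eq_mul_left (Nat.succ_pos (2 * k)) (by linarith)

end BlockDesign

section CoordinateProjections

variable {m l : ℕ} {K : Type*} [Fintype K] {b : K → Fin m → Fin m → 𝕜}

/-- The coordinate projection onto the span of the vectors `v j`, `j ∈ J`. -/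
def coordProj (v : Fin m → Fin m → 𝕜) (J : Finset (Fin m)) : Matrix (Fin m) (Fin m) 𝕜 :=
  ∑ j ∈ J, rankOne (v j)

lemma sum_coordProj_kronecker_self (v : Fin m → Fin m → 𝕜) (𝕊 : Finset (Finset (Fin m))) :
    ∑ J ∈ 𝕊, coordProj v J ⊗ₖ coordProj v J =
      ∑ i, ∑ j, (pairCount 𝕊 i j : 𝕜) • (rankOne (v i) ⊗ₖ rankOne (v j)) := by
  ext p q
  simp only [Matrix.sum_apply, Matrix.kroneckerMap_apply, coordProj, Matrix.smul_apply,
    smul_eq_mul]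
  exact sum_mul_sum_blocks 𝕊 (fun i => rankOne (v i) p.1 q.1) fun j => rankOne (v j) p.2 q.2

lemma sum_coordProj_kronecker_self_of_const {v : Fin m → Fin m → 𝕜}
    (hv : ∑ i, rankOne (v i) = 1) {𝕊 : Finset (Finset (Fin m))} {x y : 𝕜}
    (hself : ∀ i, (pairCount 𝕊 i i : 𝕜) = x + y)
    (hne : ∀ i j, i ≠ j → (pairCount 𝕊 i j : 𝕜) = x) :
    ∑ J ∈ 𝕊, coordProj v J ⊗ₖ coordProj v J =
      x • 1 + y • ∑ i, rankOne (v i) ⊗ₖ rankOne (v i) := by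
  have h1 : (1 : Matrix (Fin m × Fin m) (Fin m × Fin m) 𝕜) =
      ∑ i, ∑ j, rankOne (v i) ⊗ₖ rankOne (v j) := by
    rw [← Matrix.one_kronecker_one, ← hv]
    ext p q
    simp only [Matrix.kroneckerMap_apply, Matrix.sum_apply, Finset.sum_mul_sum]
  rw [sum_coordProj_kronecker_self, h1, Finset.smul_sum, Finset.smul_sum,
    ← Finset.sum_add_distrib]
  refine Finset.sum_congr rfl fun i _ => ?_
  have h (j : Fin m) : (pairCount 𝕊 i j : 𝕜) • (rankOne (v i) ⊗ₖ rankOne (v j)) =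
      x • (rankOne (v i) ⊗ₖ rankOne (v j)) +
        if i = j then y • (rankOne (v i) ⊗ₖ rankOne (v j)) else 0 := by
    split_ifs with hij
    · subst hij
      rw [hself, add_smul]
    · rw [hne i j hij, add_zero]
  simp only [h, Finset.sum_add_distrib, Finset.smul_sum, Finset.sum_ite_eq, Finset.mem_univ,
    if_true]

lemma exists_unitary_mulVec_eq_perm {v : Fin m → Fin m → 𝕜}
    (hv : ∀ i j, star (v i) ⬝ᵥ v j = if i = j then 1 else 0) (σ : Equiv.Perm (Fin m)) :
    ∃ U : Matrix.unitaryGroup (Fin m) 𝕜, ∀ i, (U : Matrix (Fin m) (Fin m) 𝕜) *ᵥ v i = v (σ i) := by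
  set U : Matrix (Fin m) (Fin m) 𝕜 := ∑ i, vecMulVec (v (σ i)) (star (v i)) with hUdef
  have hU : U * star U = 1 := by
    rw [← sum_rankOne_of_orthonormal hv, ← Equiv.sum_comp σ, hUdef, star_sum, Finset.sum_mul_sum]
    refine Finset.sum_congr rfl fun i _ => ?_
    simp [star_eq_conjTranspose, conjTranspose_vecMulVec, vecMulVec_mul_vecMulVec, hv, rankOne,
      apply_ite (vecMulVec _)]
  refine ⟨⟨U, Matrix.mem_unitaryGroup_iff.2 hU⟩, fun i => ?_⟩
  simp [hUdef, Matrix.sum_mulVec, vecMulVec_mulVec, hv]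

lemma trace_coordProj_mul_rankOne {v : Fin m → Fin m → 𝕜} (J : Finset (Fin m)) (w : Fin m → 𝕜) :
    (coordProj v J * rankOne w).trace = ∑ j ∈ J, (rankOne (v j) * rankOne w).trace := by
  rw [coordProj, Finset.sum_mul, Matrix.trace_sum]

/-- Pairing the second moment of the coordinate projections with two projections from one of
the bases recovers the pair counts up to an additive constant. -/
lemma IsMUBFamily.trace_sum_coordProj_mul (hb : IsMUBFamily b) {𝕊 : Finset (Finset (Fin m))}
    (hsize : ∀ J ∈ 𝕊, J.card = l) (k₀ : K) (i j : Fin m) :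
    ((∑ k, ∑ J ∈ 𝕊, coordProj (b k) J ⊗ₖ coordProj (b k) J) *
      (rankOne (b k₀ i) ⊗ₖ rankOne (b k₀ j))).trace =
      pairCount 𝕊 i j + (Fintype.card K - 1) * (𝕊.card * (l * (m : 𝕜)⁻¹) ^ 2) := by
  classical
  have h (k : K) : ∑ J ∈ 𝕊, ((coordProj (b k) J * rankOne (b k₀ i)).trace *
      (coordProj (b k) J * rankOne (b k₀ j)).trace) =
      𝕊.card * (l * (m : 𝕜)⁻¹) ^ 2 +
        if k = k₀ then pairCount 𝕊 i j - 𝕊.card * (l * (m : 𝕜)⁻¹) ^ 2 else 0 := by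
    simp only [trace_coordProj_mul_rankOne, hb.trace_mul]
    split_ifs with hk
    · simp only [Finset.sum_ite_eq', pairCount, Finset.card_filter, Nat.cast_sum, add_sub_cancel]
      refine Finset.sum_congr rfl fun J _ => ?_
      by_cases hi : i ∈ J <;> by_cases hj : j ∈ J <;> simp [hi, hj]
    · rw [Finset.sum_congr rfl fun J hJ => by rw [Finset.sum_const, hsize J hJ]]
      simp only [Finset.sum_const, nsmul_eq_mul]
      ring
  simp only [Finset.sum_mul, Matrix.trace_sum, ← Matrix.mul_kronecker_mul, Matrix.trace_kronecker,
    h, Finset.sum_add_distrib, Finset.sum_ite_eq', Finset.mem_univ, if_true, Finset.sum_const,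
    Finset.card_univ, nsmul_eq_mul]
  ring

/-- If the coordinate projections of a block collection in mutually unbiased bases form a
Grassmannian `2`-design, then the pair counts are invariant under all permutations. -/
lemma IsMUBFamily.pairCount_perm (hb : IsMUBFamily b) {𝕊 : Finset (Finset (Fin m))}
    (hsize : ∀ J ∈ 𝕊, J.card = l) (k₀ : K)
    (hdes : ∀ U : Matrix.unitaryGroup (Fin m) 𝕜,
      ∑ k, ∑ J ∈ 𝕊, coordProj (b k) J ⊗ₖ coordProj (b k) J =
        ((U : Matrix (Fin m) (Fin m) 𝕜) ⊗ₖ (U : Matrix (Fin m) (Fin m) 𝕜)) *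
          (∑ k, ∑ J ∈ 𝕊, coordProj (b k) J ⊗ₖ coordProj (b k) J) *
          (star (U : Matrix (Fin m) (Fin m) 𝕜) ⊗ₖ star (U : Matrix (Fin m) (Fin m) 𝕜)))
    (σ : Equiv.Perm (Fin m)) (i j : Fin m) :
    pairCount 𝕊 (σ i) (σ j) = pairCount 𝕊 i j := by
  obtain ⟨U, hU⟩ := exists_unitary_mulVec_eq_perm (hb.orthonormal k₀) σ
  have hUU : star (U : Matrix (Fin m) (Fin m) 𝕜) * U = 1 := Matrix.UnitaryGroup.star_mul_self U
  have hconj (i : Fin m) : star (U : Matrix (Fin m) (Fin m) 𝕜) * rankOne (b k₀ (σ i)) * U =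
      rankOne (b k₀ i) := by
    rw [← hU, rankOne_mulVec]
    simp only [← mul_assoc, hUU, one_mul]
    rw [mul_assoc, hUU, mul_one]
  have h := hb.trace_sum_coordProj_mul hsize k₀ (σ i) (σ j)
  rw [hdes U, mul_assoc, mul_assoc, Matrix.trace_mul_comm, mul_assoc,
    ← Matrix.mul_kronecker_mul, ← Matrix.mul_kronecker_mul, hconj, hconj,
    hb.trace_sum_coordProj_mul hsize k₀] at h
  exact_mod_cast (add_right_cancel h).symm

/-- The coordinate projections of a block collection in a maximal family of mutually unbiased
bases form a Grassmannian `2`-design as soon as the pair counts are constant. -/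
lemma IsMUBFamily.sum_coordProj_conj (hb : IsMUBFamily b) (hm : m ≠ 0) {c : ℝ}
    (hc : c = 0 ∨ c = 1 ∧ (RCLike.I : 𝕜) = 0) (hK : (1 + c) * Fintype.card K = m + 1 + c)
    {𝕊 : Finset (Finset (Fin m))} {x y : 𝕜}
    (hself : ∀ i, (pairCount 𝕊 i i : 𝕜) = x + y)
    (hne : ∀ i j, i ≠ j → (pairCount 𝕊 i j : 𝕜) = x)
    {U : Matrix (Fin m) (Fin m) 𝕜} (hU : U * star U = 1) :
    (U ⊗ₖ U) * (∑ k, ∑ J ∈ 𝕊, coordProj (b k) J ⊗ₖ coordProj (b k) J) * (star U ⊗ₖ star U) =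
      ∑ k, ∑ J ∈ 𝕊, coordProj (b k) J ⊗ₖ coordProj (b k) J := by
  have hc0 : (1 + c : 𝕜) ≠ 0 := by
    rcases hc with rfl | ⟨rfl, -⟩ <;> norm_num
  have hUU : (U ⊗ₖ U) * (star U ⊗ₖ star U) = 1 := by
    rw [← Matrix.mul_kronecker_mul, hU, Matrix.one_kronecker_one]
  have hsum : ∑ k, ∑ J ∈ 𝕊, coordProj (b k) J ⊗ₖ coordProj (b k) J =
      (Fintype.card K * x) • 1 + (y * (1 + c : 𝕜)⁻¹) • isotropicMatrix 𝕜 c m := by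
    rw [← hb.smul_sum_kronecker_self hm hc hK, smul_smul, inv_mul_cancel_right₀ hc0]
    simp only [fun k => sum_coordProj_kronecker_self_of_const
      (sum_rankOne_of_orthonormal (hb.orthonormal k)) hself hne, Finset.sum_add_distrib,
      Finset.sum_const, Finset.card_univ, Finset.smul_sum, ← Nat.cast_smul_eq_nsmul 𝕜, smul_smul]
  rw [hsum, mul_add, add_mul, Matrix.mul_smul, Matrix.smul_mul, mul_one, hUU, Matrix.mul_smul,
    Matrix.smul_mul, kronecker_conj_isotropicMatrix (hc.imp_right And.right) hU]

end CoordinateProjections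

open scoped Classical in
theorem stmt16 {m l : ℕ} (hl : 0 < l) (hm : m = 2 * l)
    -- a maximal set of mutually unbiased bases of `𝕜^m`, `|K| = k_𝔽(m)`
    {K : Type*} [Fintype K]
    (b : K → Fin m → (Fin m → 𝕜))
    (horth : ∀ k, ∀ j j' : Fin m, star (b k j) ⬝ᵥ b k j' = if j = j' then 1 else 0)
    (hmub : ∀ k k' : K, k ≠ k' → ∀ j j' : Fin m,
      ‖star (b k j) ⬝ᵥ b k' j'‖ ^ 2 = 1 / (m : ℝ))
    (hcard : (Fintype.card K : ℝ) =
      if (RCLike.I : 𝕜) = 0 then (m : ℝ) / 2 + 1 else (m : ℝ) + 1)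
    -- a collection of subsets of `{1,…,m}`, each of size `m/2`
    (𝕊 : Finset (Finset (Fin m)))
    (hsize : ∀ J ∈ 𝕊, J.card = l)
    -- the family of coordinate projections
    (P : K × {J // J ∈ 𝕊} → Matrix (Fin m) (Fin m) 𝕜)
    (hP : ∀ p, P p = ∑ j ∈ (p.2 : Finset (Fin m)), vecMulVec (b p.1 j) (star (b p.1 j)))
    -- forming a `(2·d_𝔽(m), m/2, m)`-fusion frame
    (hn : Fintype.card (K × {J // J ∈ 𝕊}) = 2 * dF 𝕜 m)
    (hFF : IsFusionFrame l P) :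
    -- it is a Grassmannian 2-design iff `𝕊` is a `2`-`(m, m/2, m/2-1)` block design
    ((∀ U : Matrix.unitaryGroup (Fin m) 𝕜,
      ∑ p, (P p) ⊗ₖ (P p) =
        ∑ p, ((U : Matrix (Fin m) (Fin m) 𝕜) * P p * star (U : Matrix (Fin m) (Fin m) 𝕜)) ⊗ₖ
          ((U : Matrix (Fin m) (Fin m) 𝕜) * P p * star (U : Matrix (Fin m) (Fin m) 𝕜))) ↔
    IsBlockDesign 2 m l (l - 1) 𝕊) := by
  have hm0 : m ≠ 0 := by omega
  have hb : IsMUBFamily b := ⟨horth, hmub⟩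
  obtain ⟨c, hc, hK⟩ : ∃ c : ℝ, (c = 0 ∨ c = 1 ∧ (RCLike.I : 𝕜) = 0) ∧
      (1 + c) * Fintype.card K = m + 1 + c := by
    by_cases hI : (RCLike.I : 𝕜) = 0
    · refine ⟨1, .inr ⟨rfl, hI⟩, ?_⟩
      rw [hcard, if_pos hI]
      ring
    · refine ⟨0, .inl rfl, ?_⟩
      rw [hcard, if_neg hI]
      ring
  have hKpos : 0 < Fintype.card K := by
    rw [← Nat.cast_pos (α := ℝ), hcard]
    split_ifs <;> positivity
  have hScard : 𝕊.card = 2 * (2 * l - 1) := by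
    rw [Fintype.card_prod, Fintype.card_coe] at hn
    refine Nat.eq_of_mul_eq_mul_left hKpos (hn.trans ?_)
    obtain ⟨k, rfl⟩ : ∃ k, l = k + 1 := ⟨l - 1, by omega⟩
    subst hm
    have h1 : 2 * (k + 1) - 1 = 2 * k + 1 := by omega
    by_cases hI : (RCLike.I : 𝕜) = 0
    · have hN : Fintype.card K = k + 2 := by
        rw [if_pos hI] at hcard
        push_cast at hcard
        exact_mod_cast (by linarith : (Fintype.card K : ℝ) = k + 2)
      have h2 : (2 * (k + 1) + 2) * (2 * k + 1) = 2 * ((k + 2) * (2 * k + 1)) := by ring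
      rw [dF, if_pos hI, hN, h1, h2, Nat.mul_div_cancel_left _ two_pos]
      ring
    · have hN : Fintype.card K = 2 * k + 3 := by
        rw [if_neg hI] at hcard
        push_cast at hcard
        exact_mod_cast (by linarith : (Fintype.card K : ℝ) = 2 * k + 3)
      have h2 : (2 * (k + 1)) ^ 2 - 1 = (2 * k + 3) * (2 * k + 1) := by
        rw [Nat.sub_eq_iff_eq_add (Nat.one_le_pow _ _ (by omega))]
        ring
      rw [dF, if_neg hI, hN, h1, h2]
      ring
  have hsum : ∑ p, P p ⊗ₖ P p = ∑ k, ∑ J ∈ 𝕊, coordProj (b k) J ⊗ₖ coordProj (b k) J := by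
    rw [Fintype.sum_prod_type]
    refine Finset.sum_congr rfl fun k _ => ?_
    rw [← Finset.sum_coe_sort 𝕊]
    refine Finset.sum_congr rfl fun J _ => ?_
    rw [hP]
    rfl
  have hconj (U : Matrix (Fin m) (Fin m) 𝕜) :
      ∑ p, (U * P p * star U) ⊗ₖ (U * P p * star U) =
        (U ⊗ₖ U) * (∑ k, ∑ J ∈ 𝕊, coordProj (b k) J ⊗ₖ coordProj (b k) J) *
          (star U ⊗ₖ star U) := by
    rw [← hsum, Finset.mul_sum, Finset.sum_mul]
    simp only [Matrix.mul_kronecker_mul]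
  simp only [hconj, hsum]
  rw [isBlockDesign_two_iff hsize]
  constructor
  · intro hdes i j hij
    obtain ⟨k₀⟩ := Fintype.card_pos_iff.1 hKpos
    exact pairCount_eq_of_perm_invariant hl hm hsize hScard
      (hb.pairCount_perm hsize k₀ hdes) hij
  · intro hS U
    have hself := pairCount_self_of_const hl hm hsize hScard hS
    refine (hb.sum_coordProj_conj hm0 hc hK (x := (l - 1 : ℕ)) (y := l) (fun i => ?_)
      (fun i j hij => by rw [hS i j hij]) (Matrix.mem_unitaryGroup_iff.1 U.2)).symm
    rw [hself]
    exact_mod_cast (by omega : 2 * l - 1 = l - 1 + l)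

end
end
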